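/- arXiv:1312.0964 — 7 statements merged into one kernel-verified Lean document; each statement's English description precedes it below -/
import Mathlib

section
/- In the 3-regular graph game on n vertices, regardless of who has the first move, one of the players has a strategy guaranteeing that every terminal position (the graph obtained when no legal move remains) is a planar graph; equivalently (by Wagner's characterization of planarity), the terminal graph contains neither K_5 nor K_{3,3} as a minor. -/
/-- The degree of a vertex `v` in a simple graph `G`. -/
noncomputable def deg {V : Type*} (G : SimpleGraph V) (v : V) : ℕ :=
  (G.neighborSet v).ncard

/-- A legal move in the `k`-regular graph game on `n` vertices: add an edge `uv`
with `u ≠ v`, `u, v` nonadjacent, and both of degree at most `k - 1`. -/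
def GMove (k n : ℕ) (G G' : SimpleGraph (Fin n)) : Prop :=
  ∃ u v : Fin n, u ≠ v ∧ ¬G.Adj u v ∧ deg G u < k ∧ deg G v < k ∧
    G' = G ⊔ SimpleGraph.fromEdgeSet {s(u, v)}

/-- A terminal position: no legal move remains. -/
def GTerminal (k n : ℕ) (G : SimpleGraph (Fin n)) : Prop :=
  ∀ G', ¬GMove k n G G'

/-- A strategy: a function assigning a legal move to every position admitting one. -/
def IsStrategy (k n : ℕ) (σ : SimpleGraph (Fin n) → SimpleGraph (Fin n)) : Prop :=
  ∀ G, (∃ G', GMove k n G G') → GMove k n G (σ G)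

/-- `IsPlay k n σ first f T` : `f 0, f 1, …, f T` is a maximal play of the
`k`-regular graph game starting from the empty graph, in which the designated player
(who makes move `i` for `i` even iff `first = true`) moves according to `σ`
on his turns, and the play ends at the terminal position `f T`. -/
def IsPlay (k n : ℕ) (σ : SimpleGraph (Fin n) → SimpleGraph (Fin n)) (first : Bool)
    (f : ℕ → SimpleGraph (Fin n)) (T : ℕ) : Prop :=
  f 0 = ⊥ ∧
  (∀ i < T, GMove k n (f i) (f (i + 1))) ∧
  (∀ i < T, ((i % 2 = 0) ↔ first = true) → f (i + 1) = σ (f i)) ∧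
  GTerminal k n (f T)

/-- `G` contains a `K_l` minor: `l` pairwise disjoint nonempty connected branch sets,
every pair of which is joined by an edge of `G`. -/
def HasCliqueMinor {V : Type*} (G : SimpleGraph V) (l : ℕ) : Prop :=
  ∃ B : Fin l → Set V,
    (∀ i, (B i).Nonempty) ∧
    (∀ i, (G.induce (B i)).Connected) ∧
    (∀ i j, i ≠ j → Disjoint (B i) (B j)) ∧
    (∀ i j, i ≠ j → ∃ u ∈ B i, ∃ v ∈ B j, G.Adj u v)

/-- `G` contains a `K_{3,3}` minor: six pairwise disjoint nonempty connected branch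
sets `A 0, A 1, A 2, B 0, B 1, B 2` such that every `A i` is joined to every `B j`
by an edge of `G`. -/
def HasK33Minor {V : Type*} (G : SimpleGraph V) : Prop :=
  ∃ A B : Fin 3 → Set V,
    (∀ i, (A i).Nonempty) ∧ (∀ i, (B i).Nonempty) ∧
    (∀ i, (G.induce (A i)).Connected) ∧ (∀ i, (G.induce (B i)).Connected) ∧
    (∀ i j, i ≠ j → Disjoint (A i) (A j)) ∧
    (∀ i j, i ≠ j → Disjoint (B i) (B j)) ∧
    (∀ i j, Disjoint (A i) (B j)) ∧
    (∀ i j, ∃ u ∈ A i, ∃ v ∈ B j, G.Adj u v)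

/-! ### Crossing sets of edges -/

/-- Every vertex set separating `c` from `d` is crossed by an edge of `G` lying in `E`. -/
def Cross {V : Type*} (G : SimpleGraph V) (E : Set (Sym2 V)) (c d : V) : Prop :=
  ∀ X : Set V, c ∈ X → d ∉ X → ∃ x y, x ∈ X ∧ y ∉ X ∧ G.Adj x y ∧ s(x, y) ∈ E

theorem Cross.symm {V : Type*} {G : SimpleGraph V} {E : Set (Sym2 V)} {c d : V}
    (h : Cross G E c d) : Cross G E d c := by
  intro X hd hc
  obtain ⟨x, y, hx, hy, ha, he⟩ := h Xᶜ hc (by simpa using hd)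
  exact ⟨y, x, by simpa using hy, hx, ha.symm, by rwa [Sym2.eq_swap]⟩

theorem Cross.trans {V : Type*} {G : SimpleGraph V} {E F : Set (Sym2 V)} {c m d : V}
    (h : Cross G E c m) (h' : Cross G F m d) : Cross G (E ∪ F) c d := by
  intro X hc hd
  by_cases hm : m ∈ X
  · obtain ⟨x, y, hx, hy, ha, he⟩ := h' X hm hd
    exact ⟨x, y, hx, hy, ha, Or.inr he⟩
  · obtain ⟨x, y, hx, hy, ha, he⟩ := h X hc hm
    exact ⟨x, y, hx, hy, ha, Or.inl he⟩

theorem Cross.edge {V : Type*} {G : SimpleGraph V} {u v : V} (h : G.Adj u v) :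
    Cross G {s(u, v)} u v := by
  intro X hu hv
  exact ⟨u, v, hu, hv, h, rfl⟩

theorem Cross.walk {V : Type*} {G : SimpleGraph V} {u v : V} (p : G.Walk u v) :
    Cross G {e | e ∈ p.edges} u v := by
  intro X hu hv
  obtain ⟨d, hd, h1, h2⟩ := p.exists_boundary_dart X hu hv
  exact ⟨d.fst, d.snd, h1, h2, d.adj, List.mem_map_of_mem (f := SimpleGraph.Dart.edge) hd⟩

theorem Cross.push {V : Type*} {G : SimpleGraph V} {B : Set V} {E : Set (Sym2 B)} {c d : B}
    (h : Cross (G.induce B) E c d) :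
    Cross G (Sym2.map Subtype.val '' E) (c : V) (d : V) := by
  intro X hc hd
  obtain ⟨x, y, hx, hy, ha, he⟩ := h (Subtype.val ⁻¹' X) hc hd
  exact ⟨x, y, hx, hy, by simpa using ha, ⟨_, he, by simp⟩⟩

theorem push_inside {V : Type*} {B : Set V} {E : Set (Sym2 B)} {x y : V}
    (h : s(x, y) ∈ Sym2.map Subtype.val '' E) : x ∈ B ∧ y ∈ B := by
  obtain ⟨e, -, h⟩ := h
  induction e with
  | _ a b =>
    simp only [Sym2.map_mk, Sym2.eq_iff] at h
    rcases h with ⟨rfl, rfl⟩ | ⟨rfl, rfl⟩ <;> simp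

theorem push_disjoint {V : Type*} {B : Set V} {E F : Set (Sym2 B)} (h : Disjoint E F) :
    Disjoint (Sym2.map Subtype.val '' E) (Sym2.map Subtype.val '' F) :=
  (Set.disjoint_image_iff (Sym2.map.injective Subtype.val_injective)).2 h

/-! ### Spiders in connected graphs -/

theorem exists_first_hit {W : Type*} {H : SimpleGraph W} (S : Set W) {a b : W} (q : H.Walk a b)
    (hb : b ∈ S) : ∃ c ∈ S, ∃ q' : H.Walk a c, ∀ x y, s(x, y) ∈ q'.edges → ¬ (x ∈ S ∧ y ∈ S) := by
  induction q with
  | nil => exact ⟨_, hb, .nil, by simp⟩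
  | @cons u v w h p ih =>
    by_cases hu : u ∈ S
    · exact ⟨u, hu, .nil, by simp⟩
    · obtain ⟨c, hc, q', hq'⟩ := ih hb
      refine ⟨c, hc, .cons h q', ?_⟩
      intro x y hxy
      rw [SimpleGraph.Walk.edges_cons, List.mem_cons] at hxy
      rcases hxy with hxy | hxy
      · rw [Sym2.eq_iff] at hxy
        rcases hxy with ⟨rfl, rfl⟩ | ⟨rfl, rfl⟩ <;> tauto
      · exact hq' x y hxy

/-- A walk that leaves `S` at once has no common edge with a walk inside `S`. -/
theorem not_both {W : Type*} {H : SimpleGraph W} {S : Set W} {a b c d : W} {q : H.Walk a b}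
    {p : H.Walk c d} (hq : ∀ x y, s(x, y) ∈ q.edges → ¬ (x ∈ S ∧ y ∈ S))
    (hp : ∀ x ∈ p.support, x ∈ S) : Disjoint {e | e ∈ p.edges} {e | e ∈ q.edges} := by
  rw [Set.disjoint_left]
  intro e
  induction e with
  | _ x y =>
    intro h1 h2
    exact hq x y h2 ⟨hp _ (p.fst_mem_support_of_mem_edges h1), hp _ (p.snd_mem_support_of_mem_edges h1)⟩

theorem trail_split {W : Type*} {H : SimpleGraph W} [DecidableEq W] {a b c : W} {p : H.Walk a b}
    (hp : p.IsTrail) (hc : c ∈ p.support) :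
    Disjoint {e | e ∈ (p.takeUntil c hc).edges} {e | e ∈ (p.dropUntil c hc).edges} := by
  have h := hp.edges_nodup
  rw [← p.take_spec hc, SimpleGraph.Walk.edges_append, List.nodup_append] at h
  rw [Set.disjoint_left]
  intro e h1 h2
  exact h.2.2 e h1 e h2 rfl

theorem exists_spider {W : Type*} {H : SimpleGraph W} (hH : H.Connected) (a₁ a₂ a₃ : W) :
    ∃ (c : W) (p₁ : H.Walk c a₁) (p₂ : H.Walk c a₂) (p₃ : H.Walk c a₃),
      p₁.IsTrail ∧ p₂.IsTrail ∧ p₃.IsTrail ∧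
      Disjoint {e | e ∈ p₁.edges} {e | e ∈ p₂.edges} ∧
      Disjoint {e | e ∈ p₁.edges} {e | e ∈ p₃.edges} ∧
      Disjoint {e | e ∈ p₂.edges} {e | e ∈ p₃.edges} := by
  classical
  obtain ⟨p0⟩ := hH.preconnected a₁ a₂
  have hp : p0.bypass.IsTrail := p0.bypass_isPath.isTrail
  set p := p0.bypass with hpdef
  obtain ⟨q0⟩ := hH.preconnected a₃ a₁
  obtain ⟨c, hc, q, hq⟩ := exists_first_hit {x | x ∈ p.support} q0 p.start_mem_support
  have hq' : ∀ x y, s(x, y) ∈ q.bypass.edges → ¬ (x ∈ {x | x ∈ p.support} ∧ y ∈ {x | x ∈ p.support}) :=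
    fun x y h => hq x y (q.edges_bypass_subset_edges h)
  have hsplit := trail_split hp hc
  have d1 : Disjoint {e | e ∈ (p.takeUntil c hc).edges} {e | e ∈ q.bypass.edges} :=
    not_both hq' (fun x hx => p.support_takeUntil_subset_support hc hx)
  have d2 : Disjoint {e | e ∈ (p.dropUntil c hc).edges} {e | e ∈ q.bypass.edges} :=
    not_both hq' (fun x hx => p.support_dropUntil_subset_support hc hx)
  refine ⟨c, (p.takeUntil c hc).reverse, p.dropUntil c hc, q.bypass.reverse, ?_, ?_, ?_, ?_, ?_, ?_⟩
  · exact (hp.takeUntil hc).reverse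
  · exact hp.dropUntil hc
  · exact q.bypass_isPath.isTrail.reverse
  · simpa using hsplit
  · simpa using d1
  · simpa using d2

/-- An `H`-shaped system of edge-disjoint connections: `c` to `a₁, a₂, d` and `d` to `a₃, a₄`. -/
def HShape {W : Type*} (H : SimpleGraph W) (a₁ a₂ a₃ a₄ : W) : Prop :=
  ∃ (c d : W) (L : Fin 4 → Set (Sym2 W)) (M : Set (Sym2 W)),
    (∀ i j, i ≠ j → Disjoint (L i) (L j)) ∧ (∀ i, Disjoint M (L i)) ∧
    Cross H (L 0) c a₁ ∧ Cross H (L 1) c a₂ ∧ Cross H (L 2) d a₃ ∧ Cross H (L 3) d a₄ ∧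
    Cross H M c d

theorem hshape_aux {W : Type*} {H : SimpleGraph W} {a₁ a₂ a₃ a₄ c d : W} {S : Set W}
    (p₁ : H.Walk c a₁) (p₂ : H.Walk c a₂) (p₃ : H.Walk c a₃) (q : H.Walk a₄ d)
    (h3 : p₃.IsTrail)
    (d12 : Disjoint {e | e ∈ p₁.edges} {e | e ∈ p₂.edges})
    (d13 : Disjoint {e | e ∈ p₁.edges} {e | e ∈ p₃.edges})
    (d23 : Disjoint {e | e ∈ p₂.edges} {e | e ∈ p₃.edges})
    (hq : ∀ x y, s(x, y) ∈ q.edges → ¬ (x ∈ S ∧ y ∈ S))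
    (s1 : ∀ x ∈ p₁.support, x ∈ S) (s2 : ∀ x ∈ p₂.support, x ∈ S) (s3 : ∀ x ∈ p₃.support, x ∈ S)
    (hd : d ∈ p₃.support) : HShape H a₁ a₂ a₃ a₄ := by
  classical
  have q1 := not_both hq s1
  have q2 := not_both hq s2
  have q3 := not_both hq s3
  have hs := trail_split h3 hd
  have t1 : {e | e ∈ (p₃.takeUntil d hd).edges} ⊆ {e | e ∈ p₃.edges} :=
    fun e he => p₃.edges_takeUntil_subset_edges hd he
  have t2 : {e | e ∈ (p₃.dropUntil d hd).edges} ⊆ {e | e ∈ p₃.edges} :=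
    fun e he => p₃.edges_dropUntil_subset_edges hd he
  refine ⟨c, d, ![{e | e ∈ p₁.edges}, {e | e ∈ p₂.edges}, {e | e ∈ (p₃.dropUntil d hd).edges},
    {e | e ∈ q.edges}], {e | e ∈ (p₃.takeUntil d hd).edges}, ?_, ?_, Cross.walk p₁, Cross.walk p₂,
    Cross.walk _, (Cross.walk q).symm, Cross.walk _⟩
  · have e1 := d13.mono_right t2
    have e2 := d23.mono_right t2
    have e3 := q3.mono_left t2
    intro i j hij
    fin_cases i <;> fin_cases j <;> first | exact absurd rfl hij | assumption | (apply Disjoint.symm; assumption)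
  · have e1 := (d13.mono_right t1).symm
    have e2 := (d23.mono_right t1).symm
    have e3 := q3.mono_left t1
    intro i
    fin_cases i <;> assumption

theorem exists_hshape {W : Type*} {H : SimpleGraph W} (hH : H.Connected) (a₁ a₂ a₃ a₄ : W) :
    HShape H a₂ a₃ a₁ a₄ ∨ HShape H a₁ a₃ a₂ a₄ ∨ HShape H a₁ a₂ a₃ a₄ := by
  obtain ⟨c, p₁, p₂, p₃, h1, h2, h3, d12, d13, d23⟩ := exists_spider hH a₁ a₂ a₃
  obtain ⟨q0⟩ := hH.preconnected a₄ c
  obtain ⟨d, hd, q, hq⟩ := exists_first_hit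
    {x | x ∈ p₁.support ∨ x ∈ p₂.support ∨ x ∈ p₃.support} q0 (Or.inl p₁.start_mem_support)
  have s1 : ∀ x ∈ p₁.support, x ∈ {x | x ∈ p₁.support ∨ x ∈ p₂.support ∨ x ∈ p₃.support} :=
    fun x hx => Or.inl hx
  have s2 : ∀ x ∈ p₂.support, x ∈ {x | x ∈ p₁.support ∨ x ∈ p₂.support ∨ x ∈ p₃.support} :=
    fun x hx => Or.inr (Or.inl hx)
  have s3 : ∀ x ∈ p₃.support, x ∈ {x | x ∈ p₁.support ∨ x ∈ p₂.support ∨ x ∈ p₃.support} :=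
    fun x hx => Or.inr (Or.inr hx)
  rcases hd with hd | hd | hd
  · exact Or.inl (hshape_aux p₂ p₃ p₁ q h1 d23 d12.symm d13.symm hq s2 s3 s1 hd)
  · exact Or.inr (Or.inl (hshape_aux p₁ p₃ p₂ q h2 d13 d12 d23.symm hq s1 s3 s2 hd))
  · exact Or.inr (Or.inr (hshape_aux p₁ p₂ p₃ q h3 d12 d13 d23 hq s1 s2 s3 hd))

/-! ### Counting edges between vertex sets -/

open Classical in
/-- The number of ordered adjacent pairs in `A × B`. -/
noncomputable def ee {V : Type*} [Fintype V] (G : SimpleGraph V) (A B : Finset V) : ℕ :=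
  ∑ x : V × V, if x.1 ∈ A ∧ x.2 ∈ B ∧ G.Adj x.1 x.2 then 1 else 0

section counting

set_option linter.unusedSectionVars false

variable {V : Type*} [Fintype V] [DecidableEq V] {G G' : SimpleGraph V}

theorem ee_mono (h : G ≤ G') (A B : Finset V) : ee G A B ≤ ee G' A B := by
  classical
  refine Finset.sum_le_sum fun x _ => ?_
  have := @h x.1 x.2
  split_ifs <;> simp_all

theorem ee_union_left {A B : Finset V} (h : Disjoint A B) (C : Finset V) :
    ee G (A ∪ B) C = ee G A C + ee G B C := by
  classical
  rw [ee, ee, ee, ← Finset.sum_add_distrib]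
  refine Finset.sum_congr rfl fun x _ => ?_
  have : x.1 ∈ A → x.1 ∉ B := fun hx => Finset.disjoint_left.1 h hx
  simp only [Finset.mem_union]
  by_cases h1 : x.1 ∈ A <;> by_cases h2 : x.1 ∈ B <;> simp_all

theorem ee_comm (A B : Finset V) : ee G A B = ee G B A := by
  classical
  rw [ee, ee]
  refine Fintype.sum_equiv (Equiv.prodComm V V) _ _ fun x => ?_
  simp only [Equiv.prodComm_apply, Prod.fst_swap, Prod.snd_swap, G.adj_comm x.2 x.1]
  congr 1
  simp only [eq_iff_iff]
  tauto

theorem ee_union_right {A B : Finset V} (h : Disjoint A B) (C : Finset V) :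
    ee G C (A ∪ B) = ee G C A + ee G C B := by
  rw [ee_comm, ee_union_left h, ee_comm A, ee_comm B]

theorem ee_pos {A B : Finset V} {u v : V} (hu : u ∈ A) (hv : v ∈ B) (h : G.Adj u v) :
    1 ≤ ee G A B := by
  classical
  rw [ee]
  refine le_trans ?_ (Finset.single_le_sum (fun _ _ => Nat.zero_le _) (Finset.mem_univ (u, v)))
  simp [hu, hv, h]

theorem ee_univ (A : Finset V) : ee G A Finset.univ = ∑ v ∈ A, deg G v := by
  classical
  rw [ee, Fintype.sum_prod_type, ← Finset.sum_subset (Finset.subset_univ A)]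
  · refine Finset.sum_congr rfl fun v hv => ?_
    simp only [hv, Finset.mem_univ, true_and]
    rw [deg, Finset.sum_boole, Set.ncard_eq_toFinset_card']
    simp only [Nat.cast_id]
    congr 1
    ext y
    simp
  · intro x _ hx
    simp [hx]

theorem ee_compl (A : Finset V) : ee G A A + ee G A Aᶜ = ∑ v ∈ A, deg G v := by
  rw [← ee_union_right disjoint_compl_right, Finset.union_compl, ee_univ]

theorem exists_stub {A : Finset V} (h : ee G A A + ee G A Aᶜ < 3 * A.card) :
    ∃ v ∈ A, deg G v < 3 := by
  by_contra! hc
  rw [ee_compl] at h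
  have := Finset.sum_le_sum hc
  simp at this
  omega

theorem ee_compl_le (hd : ∀ v, deg G v ≤ 3) (A : Finset V) :
    ee G A A + ee G A Aᶜ ≤ 3 * A.card := by
  rw [ee_compl]
  have := Finset.sum_le_sum (s := A) fun v _ => hd v
  simp at this
  omega

/-- Pairwise disjoint edge sets, each meeting the boundary of `X`. -/
theorem card_le_ee {ι : Type*} [Fintype ι] (X : Finset V) (E : ι → Set (Sym2 V))
    (hE : ∀ i j, i ≠ j → Disjoint (E i) (E j))
    (h : ∀ i, ∃ x y, x ∈ X ∧ y ∉ X ∧ G.Adj x y ∧ s(x, y) ∈ E i) :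
    Fintype.card ι ≤ ee G X Xᶜ := by
  classical
  choose x y hx hy ha he using h
  have : ee G X Xᶜ = (Finset.univ.filter fun z : V × V =>
      z.1 ∈ X ∧ z.2 ∈ Xᶜ ∧ G.Adj z.1 z.2).card := by
    rw [ee, Finset.card_filter]
    exact Finset.sum_congr rfl fun x _ => by congr
  rw [this, ← Finset.card_univ]
  refine Finset.card_le_card_of_injOn (fun i => (x i, y i)) ?_ ?_
  · intro i _
    simp [hx, hy, ha]
  · intro i _ j _ hij
    by_contra hne
    simp only [Prod.mk.injEq] at hij
    have h1 := he j
    rw [← hij.1, ← hij.2] at h1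
    exact Set.disjoint_left.1 (hE i j hne) (he i) h1

end counting

/-! ### Edge-disjoint realizations of `K_{3,3}` -/

/-- Six distinct centres joined as in `K_{3,3}` through pairwise disjoint edge sets. -/
def Immersion {V : Type*} (G : SimpleGraph V) : Prop :=
  ∃ (c : Fin 3 ⊕ Fin 3 → V) (E : Fin 3 × Fin 3 → Set (Sym2 V)), Function.Injective c ∧
    (∀ i j, i ≠ j → Disjoint (E i) (E j)) ∧
    ∀ i j, Cross G (E (i, j)) (c (.inl i)) (c (.inr j))

section immersion

variable {V : Type*} {G : SimpleGraph V}

/-- The edges used between the regions `i` and `j`. -/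
def pe {ι : Type*} (att : ι → ι → V) (L : ι → ι → Set (Sym2 V)) (i j : ι) : Set (Sym2 V) :=
  L i j ∪ {s(att i j, att j i)} ∪ L j i

theorem pe_disjoint {ι : Type*} {B : ι → Set V} {att : ι → ι → V} {L : ι → ι → Set (Sym2 V)}
    (hB : ∀ i j, i ≠ j → Disjoint (B i) (B j)) (hatt : ∀ i j, i ≠ j → att i j ∈ B i)
    (hL : ∀ i j x y, s(x, y) ∈ L i j → x ∈ B i ∧ y ∈ B i)
    (hLd : ∀ i j j', j ≠ j' → Disjoint (L i j) (L i j'))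
    {i j i' j' : ι} (hij : i ≠ j) (hij' : i' ≠ j') (hne : s(i, j) ≠ s(i', j')) :
    Disjoint (pe att L i j) (pe att L i' j') := by
  have hB' : ∀ i j x, x ∈ B i → x ∈ B j → i = j := by
    intro i j x h1 h2
    by_contra h
    exact Set.disjoint_left.1 (hB i j h) h1 h2
  have hLd' : ∀ i j i' j' x y, s(x, y) ∈ L i j → s(x, y) ∈ L i' j' → i = i' ∧ j = j' := by
    intro i j i' j' x y h1 h2
    obtain rfl := hB' _ _ _ (hL _ _ _ _ h1).1 (hL _ _ _ _ h2).1
    refine ⟨rfl, ?_⟩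
    by_contra h
    exact Set.disjoint_left.1 (hLd i j j' h) h1 h2
  have hmid : ∀ i j k l x y, i ≠ j → s(x, y) = s(att i j, att j i) → s(x, y) ∈ L k l → False := by
    intro i j k l x y hn h1 h2
    have h3 := hL _ _ _ _ h2
    have h4 := hatt i j hn
    have h5 := hatt j i hn.symm
    rw [Sym2.eq_iff] at h1
    rcases h1 with ⟨rfl, rfl⟩ | ⟨rfl, rfl⟩
    · exact hn ((hB' _ _ _ h4 h3.1).trans (hB' _ _ _ h5 h3.2).symm)
    · exact hn ((hB' _ _ _ h4 h3.2).trans (hB' _ _ _ h5 h3.1).symm)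
  have hmid2 : s(att i j, att j i) ≠ s(att i' j', att j' i') := by
    intro h
    have h1 := hatt i j hij
    have h2 := hatt j i hij.symm
    have h3 := hatt i' j' hij'
    have h4 := hatt j' i' hij'.symm
    rw [Sym2.eq_iff] at h
    rcases h with ⟨e1, e2⟩ | ⟨e1, e2⟩
    · rw [← e1] at h3; rw [← e2] at h4
      exact hne (by rw [hB' _ _ _ h1 h3, hB' _ _ _ h2 h4])
    · rw [← e1] at h4; rw [← e2] at h3
      exact hne (by rw [hB' _ _ _ h1 h4, hB' _ _ _ h2 h3, Sym2.eq_swap])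
  rw [Set.disjoint_left]
  intro e
  induction e with
  | _ x y =>
    rintro ((h1 | h1) | h1) ((h2 | h2) | h2)
    · obtain ⟨rfl, rfl⟩ := hLd' _ _ _ _ _ _ h1 h2; exact hne rfl
    · exact hmid _ _ _ _ _ _ hij' h2 h1
    · obtain ⟨rfl, rfl⟩ := hLd' _ _ _ _ _ _ h1 h2; exact hne Sym2.eq_swap
    · exact hmid _ _ _ _ _ _ hij h1 h2
    · exact hmid2 (Eq.trans (Eq.symm h1) h2)
    · exact hmid _ _ _ _ _ _ hij h1 h2
    · obtain ⟨rfl, rfl⟩ := hLd' _ _ _ _ _ _ h1 h2; exact hne Sym2.eq_swap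
    · exact hmid _ _ _ _ _ _ hij' h2 h1
    · obtain ⟨rfl, rfl⟩ := hLd' _ _ _ _ _ _ h1 h2; exact hne rfl

theorem pe_disjoint_mid {ι : Type*} {B : ι → Set V} {att : ι → ι → V} {L : ι → ι → Set (Sym2 V)}
    (hB : ∀ i j, i ≠ j → Disjoint (B i) (B j)) (hatt : ∀ i j, i ≠ j → att i j ∈ B i)
    (hL : ∀ i j x y, s(x, y) ∈ L i j → x ∈ B i ∧ y ∈ B i) {k : ι} {M : Set (Sym2 V)}
    (hM : ∀ x y, s(x, y) ∈ M → x ∈ B k ∧ y ∈ B k) (hML : ∀ j, Disjoint M (L k j))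
    {i j : ι} (hij : i ≠ j) : Disjoint M (pe att L i j) := by
  have hB' : ∀ i j x, x ∈ B i → x ∈ B j → i = j := by
    intro i j x h1 h2
    by_contra h
    exact Set.disjoint_left.1 (hB i j h) h1 h2
  have key : ∀ i j x y, s(x, y) ∈ M → s(x, y) ∈ L i j → False := by
    intro i j x y h1 h2
    obtain rfl := hB' _ _ _ (hM _ _ h1).1 (hL _ _ _ _ h2).1
    exact Set.disjoint_left.1 (hML j) h1 h2
  rw [Set.disjoint_left]
  intro e
  induction e with
  | _ x y =>
    rintro h ((h2 | h2) | h2)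
    · exact key _ _ _ _ h h2
    · have h3 := hM _ _ h
      have h4 := hatt i j hij
      have h5 := hatt j i hij.symm
      rw [Set.mem_singleton_iff, Sym2.eq_iff] at h2
      rcases h2 with ⟨rfl, rfl⟩ | ⟨rfl, rfl⟩
      · exact hij ((hB' _ _ _ h4 h3.1).trans (hB' _ _ _ h5 h3.2).symm)
      · exact hij ((hB' _ _ _ h4 h3.2).trans (hB' _ _ _ h5 h3.1).symm)
    · exact key _ _ _ _ h h2

theorem pe_cross {ι : Type*} {att : ι → ι → V} {L : ι → ι → Set (Sym2 V)} {i j : ι} {c d : V}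
    (ha : G.Adj (att i j) (att j i)) (h1 : Cross G (L i j) c (att i j))
    (h2 : Cross G (L j i) d (att j i)) : Cross G (pe att L i j) c d :=
  (h1.trans (Cross.edge ha)).trans h2.symm

/-- Three legs in a branch set, indexed by the target branch sets. -/
theorem exists_legs {ι : Type*} {B : Set V} (hB : (G.induce B).Connected) (att : ι → V)
    (t₁ t₂ t₃ : ι) (h12 : t₁ ≠ t₂) (h13 : t₁ ≠ t₃) (h23 : t₂ ≠ t₃)
    (h1 : att t₁ ∈ B) (h2 : att t₂ ∈ B) (h3 : att t₃ ∈ B) :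
    ∃ c ∈ B, ∃ L : ι → Set (Sym2 V), (∀ j x y, s(x, y) ∈ L j → x ∈ B ∧ y ∈ B) ∧
      (∀ j j', j ≠ j' → Disjoint (L j) (L j')) ∧
      Cross G (L t₁) c (att t₁) ∧ Cross G (L t₂) c (att t₂) ∧ Cross G (L t₃) c (att t₃) := by
  classical
  obtain ⟨c, p₁, p₂, p₃, -, -, -, d12, d13, d23⟩ :=
    exists_spider hB ⟨_, h1⟩ ⟨_, h2⟩ ⟨_, h3⟩
  have k1 := (Cross.walk p₁).push
  have k2 := (Cross.walk p₂).push
  have k3 := (Cross.walk p₃).push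
  have D12 := push_disjoint d12
  have D13 := push_disjoint d13
  have D23 := push_disjoint d23
  refine ⟨c, c.2, fun j => if j = t₁ then Sym2.map Subtype.val '' {e | e ∈ p₁.edges} else
    if j = t₂ then Sym2.map Subtype.val '' {e | e ∈ p₂.edges} else
    if j = t₃ then Sym2.map Subtype.val '' {e | e ∈ p₃.edges} else ∅, ?_, ?_, ?_, ?_, ?_⟩
  · intro j x y h
    dsimp only at h
    split_ifs at h
    · exact push_inside h
    · exact push_inside h
    · exact push_inside h
    · exact absurd h (Set.notMem_empty _)
  · intro j j' hne
    dsimp only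
    split_ifs <;> first
      | exact disjoint_bot_left
      | exact disjoint_bot_right
      | assumption
      | (apply Disjoint.symm; assumption)
      | (exfalso; apply hne; simp_all)
  · simpa using k1
  · simpa [h12.symm] using k2
  · simpa [h13.symm, h23.symm] using k3

theorem immersion_of_K33 (h : HasK33Minor G) : Immersion G := by
  obtain ⟨A, B, -, -, hA, hB, dA, dB, dAB, hadj⟩ := h
  choose u hu v hv huv using hadj
  let R : Fin 3 ⊕ Fin 3 → Set V := Sum.elim A B
  let att : Fin 3 ⊕ Fin 3 → Fin 3 ⊕ Fin 3 → V := fun x y => match x, y with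
    | .inl i, .inr j => u i j
    | .inr j, .inl i => v i j
    | .inl i, .inl _ => u i 0
    | .inr j, .inr _ => v 0 j
  have hatt : ∀ x y, att x y ∈ R x := by
    rintro (i | i) (j | j)
    · exact hu _ _
    · exact hu _ _
    · exact hv _ _
    · exact hv _ _
  have hR : ∀ x y, x ≠ y → Disjoint (R x) (R y) := by
    rintro (i | i) (j | j) h
    · exact dA _ _ (by simpa using h)
    · exact dAB _ _
    · exact (dAB _ _).symm
    · exact dB _ _ (by simpa using h)
  have hleg : ∀ x : Fin 3 ⊕ Fin 3, ∃ c ∈ R x, ∃ L : Fin 3 ⊕ Fin 3 → Set (Sym2 V),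
      (∀ j a b, s(a, b) ∈ L j → a ∈ R x ∧ b ∈ R x) ∧
      (∀ j j', j ≠ j' → Disjoint (L j) (L j')) ∧
      ∀ k : Fin 3, Cross G (L (Sum.swap (x.map (fun _ => k) (fun _ => k)))) c
        (att x (Sum.swap (x.map (fun _ => k) (fun _ => k)))) := by
    rintro (i | i)
    · obtain ⟨c, hc, L, h1, h2, k1, k2, k3⟩ := exists_legs (hA i) (att (.inl i)) (.inr 0) (.inr 1)
        (.inr 2) (by simp) (by simp) (by simp) (hu _ _) (hu _ _) (hu _ _)
      refine ⟨c, hc, L, h1, h2, ?_⟩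
      intro k
      fin_cases k <;> assumption
    · obtain ⟨c, hc, L, h1, h2, k1, k2, k3⟩ := exists_legs (hB i) (att (.inr i)) (.inl 0) (.inl 1)
        (.inl 2) (by simp) (by simp) (by simp) (hv _ _) (hv _ _) (hv _ _)
      refine ⟨c, hc, L, h1, h2, ?_⟩
      intro k
      fin_cases k <;> assumption
  choose c hc L hL hLd hcross using hleg
  refine ⟨c, fun x => pe att L (.inl x.1) (.inr x.2), ?_, ?_, ?_⟩
  · intro x y hxy
    by_contra hne
    have := hc y
    rw [← hxy] at this
    exact Set.disjoint_left.1 (hR x y hne) (hc x) this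
  · rintro ⟨i, j⟩ ⟨i', j'⟩ hne
    refine pe_disjoint hR (fun x y _ => hatt x y) hL hLd (by simp) (by simp) ?_
    simpa using hne
  · intro i j
    exact pe_cross (huv i j) (hcross (.inl i) j) (hcross (.inr j) i)

theorem immersion_of_K5_aux [Fintype V] (hdeg : ∀ v, deg G v ≤ 3) (B : Fin 5 → Set V)
    (att : Fin 5 → Fin 5 → V)
    (hc : ∀ i, (G.induce (B i)).Connected) (hB : ∀ i j, i ≠ j → Disjoint (B i) (B j))
    (hatt : ∀ i j, i ≠ j → att i j ∈ B i)
    (hadj : ∀ i j, i ≠ j → G.Adj (att i j) (att j i))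
    (hH : HShape (G.induce (B 0)) ⟨_, hatt 0 1 (by decide)⟩ ⟨_, hatt 0 2 (by decide)⟩
      ⟨_, hatt 0 3 (by decide)⟩ ⟨_, hatt 0 4 (by decide)⟩) : Immersion G := by
  classical
  obtain ⟨c, d, L0, M, hL0, hML0, k1, k2, k3, k4, km⟩ := hH
  obtain ⟨c1, hc1, L1, i1, d1, x10, x13, x14⟩ := exists_legs (hc 1) (att 1) 0 3 4
    (by decide) (by decide) (by decide) (hatt _ _ (by decide)) (hatt _ _ (by decide)) (hatt _ _ (by decide))
  obtain ⟨c2, hc2, L2, i2, d2, x20, x23, x24⟩ := exists_legs (hc 2) (att 2) 0 3 4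
    (by decide) (by decide) (by decide) (hatt _ _ (by decide)) (hatt _ _ (by decide)) (hatt _ _ (by decide))
  obtain ⟨c3, hc3, L3, i3, d3, x30, x31, x32⟩ := exists_legs (hc 3) (att 3) 0 1 2
    (by decide) (by decide) (by decide) (hatt _ _ (by decide)) (hatt _ _ (by decide)) (hatt _ _ (by decide))
  obtain ⟨c4, hc4, L4, i4, d4, x40, x41, x42⟩ := exists_legs (hc 4) (att 4) 0 1 2
    (by decide) (by decide) (by decide) (hatt _ _ (by decide)) (hatt _ _ (by decide)) (hatt _ _ (by decide))
  replace k1 := k1.push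
  replace k2 := k2.push
  replace k3 := k3.push
  replace k4 := k4.push
  replace km := km.push
  let P0 : Fin 5 → Set (Sym2 V) := ![∅, Sym2.map Subtype.val '' L0 0, Sym2.map Subtype.val '' L0 1,
    Sym2.map Subtype.val '' L0 2, Sym2.map Subtype.val '' L0 3]
  let L : Fin 5 → Fin 5 → Set (Sym2 V) := ![P0, L1, L2, L3, L4]
  have hL : ∀ i j x y, s(x, y) ∈ L i j → x ∈ B i ∧ y ∈ B i := by
    intro i j x y h
    fin_cases i
    · fin_cases j
      · exact absurd h (Set.notMem_empty _)
      all_goals exact push_inside h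
    · exact i1 _ _ _ h
    · exact i2 _ _ _ h
    · exact i3 _ _ _ h
    · exact i4 _ _ _ h
  have hLd : ∀ i j j', j ≠ j' → Disjoint (L i j) (L i j') := by
    intro i j j' h
    fin_cases i
    · have hd := fun i j h => push_disjoint (hL0 i j h)
      fin_cases j <;> fin_cases j' <;> first
        | exact absurd rfl h
        | exact disjoint_bot_left
        | exact disjoint_bot_right
        | exact hd _ _ (by decide)
    · exact d1 _ _ h
    · exact d2 _ _ h
    · exact d3 _ _ h
    · exact d4 _ _ h
  have hM : ∀ x y, s(x, y) ∈ Sym2.map Subtype.val '' M → x ∈ B 0 ∧ y ∈ B 0 :=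
    fun x y h => push_inside h
  have hML : ∀ j, Disjoint (Sym2.map Subtype.val '' M) (L 0 j) := by
    intro j
    have hd := fun i => push_disjoint (hML0 i)
    fin_cases j
    · exact disjoint_bot_right
    all_goals exact hd _
  have key := fun i j i' j' h1 h2 h3 =>
    pe_disjoint (i := i) (j := j) (i' := i') (j' := j') hB hatt hL hLd h1 h2 h3
  have keyM := fun i j h => pe_disjoint_mid (i := i) (j := j) hB hatt hL hM hML h
  have hcd : c ≠ d := by
    rintro rfl
    have := card_le_ee (G := G) {(c : V)} (fun j : Fin 4 => pe att L 0 j.succ) ?_ ?_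
    · have h2 := ee_compl_le hdeg {(c : V)}
      simp at this h2
      omega
    · intro i j hij
      exact key _ _ _ _ (Fin.succ_ne_zero _).symm (Fin.succ_ne_zero _).symm
        (by simpa using hij)
    · have hout : ∀ j : Fin 4, att j.succ 0 ∉ ((({(c : V)} : Finset V)) : Set V) := by
        intro j hj
        have h1 := hatt j.succ 0 (Fin.succ_ne_zero _)
        simp only [Finset.coe_singleton, Set.mem_singleton_iff] at hj
        rw [hj] at h1
        exact Set.disjoint_left.1 (hB _ _ (Fin.succ_ne_zero j)) h1 c.2
      intro j
      have hcr : Cross G (L 0 j.succ) c (att 0 j.succ) := by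
        fin_cases j <;> assumption
      obtain ⟨x, y, hx, hy, ha, he⟩ := (hcr.trans (Cross.edge (hadj 0 j.succ (Fin.succ_ne_zero _).symm)))
        ((({(c : V)} : Finset V)) : Set V) (by simp) (hout j)
      exact ⟨x, y, by simpa using hx, by simpa using hy, ha, Or.inl he⟩
  have hcd' : (c : V) ≠ d := fun h => hcd (Subtype.ext h)
  refine ⟨Sum.elim ![c, c3, c4] ![d, c1, c2], fun x => (![![Sym2.map Subtype.val '' M,
    pe att L 0 1, pe att L 0 2], ![pe att L 3 0, pe att L 3 1, pe att L 3 2],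
    ![pe att L 4 0, pe att L 4 1, pe att L 4 2]] : Fin 3 → Fin 3 → Set (Sym2 V)) x.1 x.2, ?_, ?_, ?_⟩
  · have hne : ∀ i j x y, i ≠ j → x ∈ B i → y ∈ B j → x ≠ y := by
      rintro i j x y h h1 h2 rfl
      exact Set.disjoint_left.1 (hB i j h) h1 h2
    have hc0 := c.2
    have hd0 := d.2
    have e01 := hne 0 1 _ _ (by decide) hc0 hc1
    have e02 := hne 0 2 _ _ (by decide) hc0 hc2
    have e03 := hne 0 3 _ _ (by decide) hc0 hc3
    have e04 := hne 0 4 _ _ (by decide) hc0 hc4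
    have f01 := hne 0 1 _ _ (by decide) hd0 hc1
    have f02 := hne 0 2 _ _ (by decide) hd0 hc2
    have f03 := hne 0 3 _ _ (by decide) hd0 hc3
    have f04 := hne 0 4 _ _ (by decide) hd0 hc4
    have g12 := hne 1 2 _ _ (by decide) hc1 hc2
    have g13 := hne 1 3 _ _ (by decide) hc1 hc3
    have g14 := hne 1 4 _ _ (by decide) hc1 hc4
    have g23 := hne 2 3 _ _ (by decide) hc2 hc3
    have g24 := hne 2 4 _ _ (by decide) hc2 hc4
    have g34 := hne 3 4 _ _ (by decide) hc3 hc4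
    rintro (i | i) (j | j) h <;> fin_cases i <;> fin_cases j <;> first
      | rfl
      | exact absurd h (by assumption)
      | exact absurd (Eq.symm h) (by assumption)
  · rintro ⟨i, j⟩ ⟨i', j'⟩ h
    fin_cases i <;> fin_cases j <;> fin_cases i' <;> fin_cases j' <;> first
      | exact absurd rfl h
      | exact key _ _ _ _ (by decide) (by decide) (by decide)
      | exact keyM _ _ (by decide)
      | exact (keyM _ _ (by decide)).symm
  · intro i j
    fin_cases i <;> fin_cases j
    · exact km
    · exact pe_cross (hadj 0 1 (by decide)) k1 x10
    · exact pe_cross (hadj 0 2 (by decide)) k2 x20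
    · exact pe_cross (hadj 3 0 (by decide)) x30 k3
    · exact pe_cross (hadj 3 1 (by decide)) x31 x13
    · exact pe_cross (hadj 3 2 (by decide)) x32 x23
    · exact pe_cross (hadj 4 0 (by decide)) x40 k4
    · exact pe_cross (hadj 4 1 (by decide)) x41 x14
    · exact pe_cross (hadj 4 2 (by decide)) x42 x24

theorem immersion_of_K5 [Fintype V] (hdeg : ∀ v, deg G v ≤ 3) (h : HasCliqueMinor G 5) :
    Immersion G := by
  obtain ⟨B, -, hc, hB, hadj⟩ := h
  choose u hu v hv huv using hadj
  let att : Fin 5 → Fin 5 → V := fun i j =>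
    if h : i = j then u 0 1 (by decide) else if i < j then u i j h else v j i (Ne.symm h)
  have hatt : ∀ i j, i ≠ j → att i j ∈ B i := by
    intro i j h
    simp only [att, h, dite_false]
    split_ifs
    · exact hu _ _ _
    · exact hv _ _ _
  have hadj : ∀ i j, i ≠ j → G.Adj (att i j) (att j i) := by
    intro i j h
    rcases lt_or_gt_of_ne h with h1 | h1
    · simp only [att, h, h.symm, dite_false, h1, if_true, not_lt_of_gt h1, if_false]
      exact huv _ _ _
    · simp only [att, h, h.symm, dite_false, h1, if_true, not_lt_of_gt h1, if_false]
      exact (huv _ _ _).symm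
  have main : ∀ e : Fin 5 → Fin 5, ∀ he : Function.Injective e,
      HShape (G.induce (B (e 0))) ⟨_, hatt (e 0) (e 1) (he.ne (by decide))⟩
        ⟨_, hatt (e 0) (e 2) (he.ne (by decide))⟩
        ⟨_, hatt (e 0) (e 3) (he.ne (by decide))⟩ ⟨_, hatt (e 0) (e 4) (he.ne (by decide))⟩ →
      Immersion G := by
    intro e he hH
    exact immersion_of_K5_aux hdeg (fun i => B (e i)) (fun i j => att (e i) (e j))
      (fun i => hc _) (fun i j h => hB _ _ (he.ne h)) (fun i j h => hatt _ _ (he.ne h))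
      (fun i j h => hadj _ _ (he.ne h)) hH
  rcases exists_hshape (hc 0) ⟨_, hatt 0 1 (by decide)⟩ ⟨_, hatt 0 2 (by decide)⟩
      ⟨_, hatt 0 3 (by decide)⟩ ⟨_, hatt 0 4 (by decide)⟩ with h | h | h
  · exact main ![0, 2, 3, 1, 4] (by decide) h
  · exact main ![0, 1, 3, 2, 4] (by decide) h
  · exact main id Function.injective_id h

end immersion

/-! ### Clusters and duos -/

section clusters

set_option linter.unusedSectionVars false

variable {V : Type*} [Fintype V] [DecidableEq V] {G G' : SimpleGraph V}

/-- Hierarchically built vertex sets which have at most three outgoing edges and free places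
(counted together), each being the union of at most four smaller ones. -/
inductive Cl (G : SimpleGraph V) : Finset V → Prop
  | empty : Cl G ∅
  | single (v : V) : Cl G {v}
  | union (A B C D : Finset V) : Cl G A → Cl G B → Cl G C → Cl G D →
      3 * (A ∪ B ∪ C ∪ D).card ≤ ee G (A ∪ B ∪ C ∪ D) (A ∪ B ∪ C ∪ D) + 3 → Cl G (A ∪ B ∪ C ∪ D)

theorem Cl.weight {A : Finset V} (h : Cl G A) : 3 * A.card ≤ ee G A A + 3 := by
  cases h with
  | empty => simp
  | single v => simp
  | union A B C D _ _ _ _ h => exact h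

theorem Cl.mono (hG : G ≤ G') {A : Finset V} (h : Cl G A) : Cl G' A := by
  induction h with
  | empty => exact .empty
  | single v => exact .single v
  | union A B C D _ _ _ _ h h1 h2 h3 h4 =>
    exact .union A B C D h1 h2 h3 h4 (h.trans (by gcongr; exact ee_mono hG _ _))

theorem ee_self_union {A B : Finset V} (h : Disjoint A B) :
    ee G (A ∪ B) (A ∪ B) = ee G A A + ee G B B + 2 * ee G A B := by
  rw [ee_union_left h, ee_union_right h, ee_union_right h, ee_comm B A]
  omega

theorem Cl.union2 {A B : Finset V} (hA : Cl G A) (hB : Cl G B) (h : Disjoint A B)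
    (hw : 3 * A.card + 3 * B.card ≤ ee G A A + ee G B B + 2 * ee G A B + 3) : Cl G (A ∪ B) := by
  have := Cl.union A B B B hA hB hB hB
  simp only [Finset.union_assoc, Finset.union_self] at this
  apply this
  rw [ee_self_union h, Finset.card_union_of_disjoint h]
  omega

theorem Cl.union3 {A B C : Finset V} (hA : Cl G A) (hB : Cl G B) (hC : Cl G C)
    (hAB : Disjoint A B) (hAC : Disjoint A C) (hBC : Disjoint B C)
    (hw : 3 * A.card + 3 * B.card + 3 * C.card ≤
      ee G A A + ee G B B + ee G C C + 2 * ee G A B + 2 * ee G A C + 2 * ee G B C + 3) :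
    Cl G (A ∪ B ∪ C) := by
  have := Cl.union A B C C hA hB hC hC
  simp only [Finset.union_assoc, Finset.union_self] at this
  rw [← Finset.union_assoc] at this
  have hd : Disjoint (A ∪ B) C := Finset.disjoint_union_left.2 ⟨hAC, hBC⟩
  apply this
  rw [ee_self_union hd, ee_self_union hAB, ee_union_left hAB, Finset.card_union_of_disjoint hd,
    Finset.card_union_of_disjoint hAB]
  omega

/-- A cluster, or two adjacent disjoint clusters. -/
def Duo (G : SimpleGraph V) (X : Finset V) : Prop :=
  Cl G X ∨ ∃ A B, Cl G A ∧ Cl G B ∧ Disjoint A B ∧ 1 ≤ ee G A B ∧ X = A ∪ B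

theorem Duo.mono (hG : G ≤ G') {X : Finset V} (h : Duo G X) : Duo G' X := by
  rcases h with h | ⟨A, B, hA, hB, hd, he, rfl⟩
  · exact Or.inl (h.mono hG)
  · exact Or.inr ⟨A, B, hA.mono hG, hB.mono hG, hd, he.trans (ee_mono hG _ _), rfl⟩

theorem ee_compl_split {X Y : Finset V} (h : X ⊆ Y) :
    ee G X Xᶜ = ee G X (Y \ X) + ee G X Yᶜ := by
  rw [← ee_union_right]
  · congr 1
    ext v
    have := @h v
    simp only [Finset.mem_compl, Finset.mem_union, Finset.mem_sdiff]
    tauto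
  · rw [Finset.disjoint_left]
    intro v hv
    simp only [Finset.mem_sdiff] at hv
    simp [hv.1]

/-- Two non-adjacent sets with free places have a legal move between them. -/
theorem exists_move {X Y : Finset V} (hd : Disjoint X Y) (he : ee G X Y = 0)
    (hX : ee G X X + ee G X Xᶜ < 3 * X.card) (hY : ee G Y Y + ee G Y Yᶜ < 3 * Y.card) :
    ∃ u v, u ∈ X ∧ v ∈ Y ∧ u ≠ v ∧ ¬ G.Adj u v ∧ deg G u < 3 ∧ deg G v < 3 ∧
      1 ≤ ee (G ⊔ SimpleGraph.fromEdgeSet {s(u, v)}) X Y := by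
  obtain ⟨u, hu, hu'⟩ := exists_stub hX
  obtain ⟨v, hv, hv'⟩ := exists_stub hY
  have hne : u ≠ v := by
    rintro rfl
    exact Finset.disjoint_left.1 hd hu hv
  refine ⟨u, v, hu, hv, hne, ?_, hu', hv', ?_⟩
  · intro h
    have := ee_pos hu hv h
    omega
  · exact ee_pos hu hv (by simp [hne])

/-- What we want to achieve on a vertex set: it is a duo, or becomes one by a legal move. -/
def Good (G : SimpleGraph V) (X : Finset V) : Prop :=
  Duo G X ∨ ∃ u v, u ∈ X ∧ v ∈ X ∧ u ≠ v ∧ ¬ G.Adj u v ∧ deg G u < 3 ∧ deg G v < 3 ∧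
    Duo (G ⊔ SimpleGraph.fromEdgeSet {s(u, v)}) X

theorem collapse_three {X₁ X₂ Y : Finset V} (h1 : Cl G X₁) (h2 : Cl G X₂) (h3 : Cl G Y)
    (d12 : Disjoint X₁ X₂) (d1 : Disjoint X₁ Y) (d2 : Disjoint X₂ Y)
    (he : 1 ≤ ee G X₁ X₂) (he' : 1 ≤ ee G X₂ Y)
    (hb : ee G (X₁ ∪ X₂) Y + ee G (X₁ ∪ X₂ ∪ Y) (X₁ ∪ X₂ ∪ Y)ᶜ ≤ 2) : Good G (X₁ ∪ X₂ ∪ Y) := by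
  by_cases hD : Duo G (X₁ ∪ X₂ ∪ Y)
  · exact Or.inl hD
  have w1 := h1.weight
  have w2 := h2.weight
  have w3 := h3.weight
  have hd : Disjoint (X₁ ∪ X₂) Y := Finset.disjoint_union_left.2 ⟨d1, d2⟩
  have n1 : ¬ (3 * X₂.card + 3 * Y.card ≤ ee G X₂ X₂ + ee G Y Y + 2 * ee G X₂ Y + 3) := by
    intro h
    refine hD (Or.inr ⟨X₁, X₂ ∪ Y, h1, h2.union2 h3 d2 h, Finset.disjoint_union_right.2 ⟨d12, d1⟩,
      ?_, Finset.union_assoc _ _ _⟩)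
    rw [ee_union_right d2]
    omega
  have n2 : ¬ (3 * X₁.card + 3 * X₂.card ≤ ee G X₁ X₁ + ee G X₂ X₂ + 2 * ee G X₁ X₂ + 3) := by
    intro h
    refine hD (Or.inr ⟨X₁ ∪ X₂, Y, h1.union2 h2 d12 h, h3, hd, ?_, rfl⟩)
    rw [ee_union_left d12]
    omega
  have n3 : ¬ (3 * X₁.card + 3 * X₂.card + 3 * Y.card ≤ ee G X₁ X₁ + ee G X₂ X₂ + ee G Y Y +
      2 * ee G X₁ X₂ + 2 * ee G X₁ Y + 2 * ee G X₂ Y + 3) :=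
    fun h => hD (Or.inl (h1.union3 h2 h3 d12 d1 d2 h))
  rw [ee_union_left d12, ee_union_left hd, ee_union_left d12] at hb
  have s1 : ee G X₁ X₁ᶜ = ee G X₁ X₂ + ee G X₁ Y + ee G X₁ (X₁ ∪ X₂ ∪ Y)ᶜ := by
    rw [ee_compl_split (Y := X₁ ∪ X₂ ∪ Y) (by grind), ← ee_union_right d2]
    congr 2
    grind [Finset.disjoint_left]
  have s3 : ee G Y Yᶜ = ee G X₁ Y + ee G X₂ Y + ee G Y (X₁ ∪ X₂ ∪ Y)ᶜ := by
    rw [ee_compl_split (Y := X₁ ∪ X₂ ∪ Y) (by grind), ← ee_union_left d12, ee_comm _ Y]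
    congr 2
    grind [Finset.disjoint_left]
  obtain ⟨u, v, hu, hv, hne, hna, hdu, hdv, hn⟩ :=
    exists_move (G := G) d1 (by omega) (by omega) (by omega)
  refine Or.inr ⟨u, v, by simp [hu], by simp [hv], hne, hna, hdu, hdv, Or.inl ?_⟩
  have hle : G ≤ G ⊔ SimpleGraph.fromEdgeSet {s(u, v)} := le_sup_left
  refine (h1.mono hle).union3 (h2.mono hle) (h3.mono hle) d12 d1 d2 ?_
  have m1 := ee_mono hle X₁ X₁
  have m2 := ee_mono hle X₂ X₂
  have m3 := ee_mono hle Y Y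
  have m4 := ee_mono hle X₁ X₂
  have m5 := ee_mono hle X₂ Y
  omega

/-- Adding an edge between `X₁` and `Y₁` in the path `X₁ - X₂ - Y₁ - Y₂` of clusters. -/
theorem four_aux {X₁ X₂ Y₁ Y₂ : Finset V} (h1 : Cl G X₁) (h2 : Cl G X₂) (h3 : Cl G Y₁)
    (h4 : Cl G Y₂) (d12 : Disjoint X₁ X₂) (e11 : Disjoint X₁ Y₁) (e12 : Disjoint X₁ Y₂)
    (e21 : Disjoint X₂ Y₁) (e22 : Disjoint X₂ Y₂) (d34 : Disjoint Y₁ Y₂)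
    (hx : 1 ≤ ee G X₁ X₂) (hy : 1 ≤ ee G Y₁ Y₂) (he : 1 ≤ ee G X₂ Y₁)
    (h0 : ee G X₁ Y₁ = 0)
    (hX : ee G X₁ X₁ + ee G X₁ X₁ᶜ < 3 * X₁.card) (hY : ee G Y₁ Y₁ + ee G Y₁ Y₁ᶜ < 3 * Y₁.card) :
    Good G (X₁ ∪ X₂ ∪ Y₁ ∪ Y₂) := by
  obtain ⟨u, v, hu, hv, hne, hna, hdu, hdv, hn⟩ := exists_move e11 h0 hX hY
  refine Or.inr ⟨u, v, by simp [hu], by simp [hv], hne, hna, hdu, hdv, Or.inr ?_⟩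
  have hle : G ≤ G ⊔ SimpleGraph.fromEdgeSet {s(u, v)} := le_sup_left
  have w1 := h1.weight
  have w2 := h2.weight
  have w3 := h3.weight
  have m1 := ee_mono hle X₁ X₁
  have m2 := ee_mono hle X₂ X₂
  have m3 := ee_mono hle Y₁ Y₁
  have m4 := ee_mono hle X₁ X₂
  have m5 := ee_mono hle X₂ Y₁
  have m6 := ee_mono hle Y₁ Y₂
  refine ⟨X₁ ∪ X₂ ∪ Y₁, Y₂, (h1.mono hle).union3 (h2.mono hle) (h3.mono hle) d12 e11 e21 (by omega),
    h4.mono hle, ?_, ?_, rfl⟩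
  · simp only [Finset.disjoint_union_left]
    exact ⟨⟨e12, e22⟩, d34⟩
  · rw [ee_union_left (Finset.disjoint_union_left.2 ⟨e11, e21⟩)]
    omega

theorem collapse_four {X₁ X₂ Y₁ Y₂ : Finset V} (h1 : Cl G X₁) (h2 : Cl G X₂) (h3 : Cl G Y₁)
    (h4 : Cl G Y₂) (d12 : Disjoint X₁ X₂) (e11 : Disjoint X₁ Y₁) (e12 : Disjoint X₁ Y₂)
    (e21 : Disjoint X₂ Y₁) (e22 : Disjoint X₂ Y₂) (d34 : Disjoint Y₁ Y₂)
    (hx : 1 ≤ ee G X₁ X₂) (hy : 1 ≤ ee G Y₁ Y₂) (he : 1 ≤ ee G X₂ Y₁)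
    (nX : ¬ Cl G (X₁ ∪ X₂)) (nY : ¬ Cl G (Y₁ ∪ Y₂))
    (hb : ee G (X₁ ∪ X₂) (Y₁ ∪ Y₂) +
      ee G (X₁ ∪ X₂ ∪ Y₁ ∪ Y₂) (X₁ ∪ X₂ ∪ Y₁ ∪ Y₂)ᶜ ≤ 2) : Good G (X₁ ∪ X₂ ∪ Y₁ ∪ Y₂) := by
  by_cases hD : Duo G (X₁ ∪ X₂ ∪ Y₁ ∪ Y₂)
  · exact Or.inl hD
  have w1 := h1.weight
  have w2 := h2.weight
  have w3 := h3.weight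
  have w4 := h4.weight
  have n1 : ¬ (3 * X₁.card + 3 * X₂.card ≤ ee G X₁ X₁ + ee G X₂ X₂ + 2 * ee G X₁ X₂ + 3) :=
    fun h => nX (h1.union2 h2 d12 h)
  have n2 : ¬ (3 * Y₁.card + 3 * Y₂.card ≤ ee G Y₁ Y₁ + ee G Y₂ Y₂ + 2 * ee G Y₁ Y₂ + 3) :=
    fun h => nY (h3.union2 h4 d34 h)
  have n3 : ¬ (3 * X₁.card + 3 * X₂.card + 3 * Y₁.card ≤ ee G X₁ X₁ + ee G X₂ X₂ + ee G Y₁ Y₁ +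
      2 * ee G X₁ X₂ + 2 * ee G X₁ Y₁ + 2 * ee G X₂ Y₁ + 3) := by
    intro h
    refine hD (Or.inr ⟨X₁ ∪ X₂ ∪ Y₁, Y₂, h1.union3 h2 h3 d12 e11 e21 h, h4, ?_, ?_, rfl⟩)
    · simp only [Finset.disjoint_union_left]
      exact ⟨⟨e12, e22⟩, d34⟩
    · rw [ee_union_left (Finset.disjoint_union_left.2 ⟨e11, e21⟩)]
      omega
  have n4 : ¬ (3 * X₂.card + 3 * Y₁.card + 3 * Y₂.card ≤ ee G X₂ X₂ + ee G Y₁ Y₁ + ee G Y₂ Y₂ +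
      2 * ee G X₂ Y₁ + 2 * ee G X₂ Y₂ + 2 * ee G Y₁ Y₂ + 3) := by
    intro h
    refine hD (Or.inr ⟨X₁, X₂ ∪ Y₁ ∪ Y₂, h1, h2.union3 h3 h4 e21 e22 d34 h, ?_, ?_, ?_⟩)
    · simp only [Finset.disjoint_union_right]
      exact ⟨⟨d12, e11⟩, e12⟩
    · rw [ee_union_right (Finset.disjoint_union_left.2 ⟨e22, d34⟩), ee_union_right e21]
      omega
    · simp only [Finset.union_assoc]
  rw [ee_union_left (Finset.disjoint_union_left.2 ⟨Finset.disjoint_union_left.2 ⟨e12, e22⟩, d34⟩),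
    ee_union_left (Finset.disjoint_union_left.2 ⟨e11, e21⟩), ee_union_left d12,
    ee_union_left d12, ee_union_right d34, ee_union_right d34] at hb
  set D := X₁ ∪ X₂ ∪ Y₁ ∪ Y₂ with hDdef
  have s1 : ee G X₁ X₁ᶜ = ee G X₁ X₂ + ee G X₁ Y₁ + ee G X₁ Y₂ + ee G X₁ Dᶜ := by
    rw [ee_compl_split (Y := D) (by grind), ← ee_union_right e21,
      ← ee_union_right (Finset.disjoint_union_left.2 ⟨e22, d34⟩)]
    congr 2
    grind [Finset.disjoint_left]
  have s2 : ee G X₂ X₂ᶜ = ee G X₁ X₂ + ee G X₂ Y₁ + ee G X₂ Y₂ + ee G X₂ Dᶜ := by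
    rw [ee_compl_split (Y := D) (by grind), ee_comm X₁ X₂, ← ee_union_right e11,
      ← ee_union_right (Finset.disjoint_union_left.2 ⟨e12, d34⟩)]
    congr 2
    grind [Finset.disjoint_left]
  have s3 : ee G Y₁ Y₁ᶜ = ee G X₁ Y₁ + ee G X₂ Y₁ + ee G Y₁ Y₂ + ee G Y₁ Dᶜ := by
    rw [ee_compl_split (Y := D) (by grind), ← ee_union_left d12, ee_comm _ Y₁,
      ← ee_union_right (Finset.disjoint_union_left.2 ⟨e12, e22⟩)]
    congr 2
    grind [Finset.disjoint_left]
  have s4 : ee G Y₂ Y₂ᶜ = ee G X₁ Y₂ + ee G X₂ Y₂ + ee G Y₁ Y₂ + ee G Y₂ Dᶜ := by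
    rw [ee_compl_split (Y := D) (by grind), ← ee_union_left d12,
      ← ee_union_left (Finset.disjoint_union_left.2 ⟨e11, e21⟩), ee_comm _ Y₂]
    congr 2
    grind [Finset.disjoint_left]
  have f1 : ee G X₁ X₂ = 1 := by omega
  have f2 : ee G Y₁ Y₂ = 1 := by omega
  have f3 : ee G X₁ X₁ + 3 = 3 * X₁.card := by omega
  have f4 : ee G X₂ X₂ + 3 = 3 * X₂.card := by omega
  have f5 : ee G Y₁ Y₁ + 3 = 3 * Y₁.card := by omega
  have f6 : ee G Y₂ Y₂ + 3 = 3 * Y₂.card := by omega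
  have f7 : ee G X₂ Y₁ = 1 := by omega
  have f8 : ee G X₁ Y₁ = 0 := by omega
  have f9 : ee G X₂ Y₂ = 0 := by omega
  clear n1 n2 n3 n4 w1 w2 w3 w4
  by_cases hc : ee G Y₁ Dᶜ = 0
  · exact four_aux h1 h2 h3 h4 d12 e11 e12 e21 e22 d34 hx hy he (by omega) (by omega) (by omega)
  · have := four_aux h4 h3 h2 h1 d34.symm e22.symm e12.symm e21.symm e11.symm d12.symm
      (by rwa [ee_comm]) (by rwa [ee_comm]) (by rwa [ee_comm]) (by rw [ee_comm]; omega)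
      (by omega) (by omega)
    have hDD : Y₂ ∪ Y₁ ∪ X₂ ∪ X₁ = D := by
      ext; simp only [hDdef, Finset.mem_union]; tauto
    rwa [hDD] at this

theorem collapse {D₁ D₂ : Finset V} (h1 : Duo G D₁) (h2 : Duo G D₂) (hd : Disjoint D₁ D₂)
    (he : 1 ≤ ee G D₁ D₂) (hb : ee G D₁ D₂ + ee G (D₁ ∪ D₂) (D₁ ∪ D₂)ᶜ ≤ 2) :
    Good G (D₁ ∪ D₂) := by
  have three : ∀ {D₁ D₂ : Finset V}, Duo G D₁ → Cl G D₂ → Disjoint D₁ D₂ →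
      1 ≤ ee G D₁ D₂ → ee G D₁ D₂ + ee G (D₁ ∪ D₂) (D₁ ∪ D₂)ᶜ ≤ 2 → Good G (D₁ ∪ D₂) := by
    intro D₁ D₂ h1 h2 hd he hb
    rcases h1 with h1 | ⟨A, B, hA, hB, hAB, hab, rfl⟩
    · exact Or.inl (Or.inr ⟨D₁, D₂, h1, h2, hd, he, rfl⟩)
    · have hd' := Finset.disjoint_union_left.1 hd
      by_cases hc : 1 ≤ ee G B D₂
      · exact collapse_three hA hB h2 hAB hd'.1 hd'.2 hab hc hb
      · rw [ee_union_left hAB] at he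
        rw [Finset.union_comm A B] at hb ⊢
        exact collapse_three hB hA h2 hAB.symm hd'.2 hd'.1 (by rwa [ee_comm]) (by omega) hb
  by_cases c2 : Cl G D₂
  · exact three h1 c2 hd he hb
  by_cases c1 : Cl G D₁
  · rw [Finset.union_comm]
    exact three h2 c1 hd.symm (by rwa [ee_comm]) (by rwa [ee_comm, Finset.union_comm])
  obtain ⟨A, B, hA, hB, hAB, hab, rfl⟩ := h1.resolve_left c1
  obtain ⟨C, D, hC, hD, hCD, hcd, rfl⟩ := h2.resolve_left c2
  have four : ∀ A B C D : Finset V, Cl G A → Cl G B → Cl G C → Cl G D → Disjoint A B →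
      Disjoint C D → 1 ≤ ee G A B → 1 ≤ ee G C D → 1 ≤ ee G B C → ¬ Cl G (A ∪ B) →
      ¬ Cl G (C ∪ D) → Disjoint (A ∪ B) (C ∪ D) →
      ee G (A ∪ B) (C ∪ D) + ee G (A ∪ B ∪ (C ∪ D)) (A ∪ B ∪ (C ∪ D))ᶜ ≤ 2 →
      Good G (A ∪ B ∪ (C ∪ D)) := by
    intro A B C D hA hB hC hD hAB hCD hab hcd hbc c1 c2 hd hb
    rw [← Finset.union_assoc (A ∪ B)] at hb ⊢
    simp only [Finset.disjoint_union_left, Finset.disjoint_union_right] at hd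
    exact collapse_four hA hB hC hD hAB hd.1.1 hd.2.1 hd.1.2 hd.2.2 hCD hab hcd hbc c1 c2 hb
  have key : 1 ≤ ee G A C ∨ 1 ≤ ee G A D ∨ 1 ≤ ee G B C ∨ 1 ≤ ee G B D := by
    rw [ee_union_left hAB, ee_union_right hCD, ee_union_right hCD] at he
    omega
  have hab' : 1 ≤ ee G B A := by rwa [ee_comm]
  have hcd' : 1 ≤ ee G D C := by rwa [ee_comm]
  rcases key with k | k | k | k
  · rw [Finset.union_comm A B] at *
    exact four B A C D hB hA hC hD hAB.symm hCD hab' hcd k c1 c2 hd hb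
  · rw [Finset.union_comm A B, Finset.union_comm C D] at *
    exact four B A D C hB hA hD hC hAB.symm hCD.symm hab' hcd' k c1 c2 hd hb
  · exact four A B C D hA hB hC hD hAB hCD hab hcd k c1 c2 hd hb
  · rw [Finset.union_comm C D] at *
    exact four A B D C hA hB hD hC hAB hCD.symm hab hcd' k c1 c2 hd hb

/-! ### No `K_{3,3}` in clusters -/

theorem cut_three : ∀ P Q : Fin 3 → Bool,
    (Finset.univ.filter fun x : Fin 3 × Fin 3 => P x.1 ≠ Q x.2).card ≤ 3 →
    (Finset.univ.filter fun s : Fin 3 ⊕ Fin 3 => Sum.elim P Q s = true).card ≤ 1 ∨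
    5 ≤ (Finset.univ.filter fun s : Fin 3 ⊕ Fin 3 => Sum.elim P Q s = true).card := by
  decide

theorem cut_two : ∀ P Q : Fin 3 → Bool,
    (Finset.univ.filter fun x : Fin 3 × Fin 3 => P x.1 ≠ Q x.2).card ≤ 2 →
    (Finset.univ.filter fun s : Fin 3 ⊕ Fin 3 => Sum.elim P Q s = true).card = 0 ∨
    5 ≤ (Finset.univ.filter fun s : Fin 3 ⊕ Fin 3 => Sum.elim P Q s = true).card := by
  decide

/-- The number of centres in `X`. -/
def bb (c : Fin 3 ⊕ Fin 3 → V) (X : Finset V) : ℕ :=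
  (Finset.univ.filter fun s => c s ∈ X).card

theorem bb_union (c : Fin 3 ⊕ Fin 3 → V) (X Y : Finset V) : bb c (X ∪ Y) ≤ bb c X + bb c Y := by
  unfold bb
  refine le_trans (Finset.card_le_card ?_) (Finset.card_union_le _ _)
  intro s
  simp

theorem cut_le {c : Fin 3 ⊕ Fin 3 → V} {E : Fin 3 × Fin 3 → Set (Sym2 V)}
    (hE : ∀ i j, i ≠ j → Disjoint (E i) (E j))
    (hcr : ∀ i j, Cross G (E (i, j)) (c (.inl i)) (c (.inr j))) (X : Finset V) :
    (Finset.univ.filter fun x : Fin 3 × Fin 3 =>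
      decide (c (.inl x.1) ∈ X) ≠ decide (c (.inr x.2) ∈ X)).card ≤ ee G X Xᶜ := by
  rw [← Fintype.card_subtype]
  refine card_le_ee X (fun x => E x.1) ?_ ?_
  · intro i j hij
    exact hE _ _ (fun h => hij (Subtype.ext h))
  · rintro ⟨⟨i, j⟩, h⟩
    by_cases h1 : c (.inl i) ∈ X <;> by_cases h2 : c (.inr j) ∈ X
    · simp [h1, h2] at h
    · exact hcr i j X h1 h2
    · exact (hcr i j).symm X h2 h1
    · simp [h1, h2] at h

theorem bb_eq (c : Fin 3 ⊕ Fin 3 → V) (X : Finset V) :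
    (Finset.univ.filter fun s : Fin 3 ⊕ Fin 3 => Sum.elim (fun i => decide (c (.inl i) ∈ X))
      (fun j => decide (c (.inr j) ∈ X)) s = true).card = bb c X := by
  unfold bb
  congr 1
  ext s
  rcases s with s | s <;> simp

theorem Cl.bb_le (hdeg : ∀ v, deg G v ≤ 3) {c : Fin 3 ⊕ Fin 3 → V}
    {E : Fin 3 × Fin 3 → Set (Sym2 V)} (hc : Function.Injective c)
    (hE : ∀ i j, i ≠ j → Disjoint (E i) (E j))
    (hcr : ∀ i j, Cross G (E (i, j)) (c (.inl i)) (c (.inr j))) {X : Finset V} (h : Cl G X) :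
    bb c X ≤ 1 := by
  induction h with
  | empty => simp [bb]
  | single v =>
    unfold bb
    rw [Finset.card_le_one]
    intro a ha b hb
    simp only [Finset.mem_filter, Finset.mem_univ, true_and, Finset.mem_singleton] at ha hb
    exact hc (ha.trans hb.symm)
  | union A B C D _ _ _ _ h h1 h2 h3 h4 =>
    have k1 := bb_union c (A ∪ B ∪ C) D
    have k2 := bb_union c (A ∪ B) C
    have k3 := bb_union c A B
    have k4 := ee_compl_le hdeg (A ∪ B ∪ C ∪ D)
    have k5 := cut_le hE hcr (A ∪ B ∪ C ∪ D)
    have k6 := cut_three (fun i => decide (c (.inl i) ∈ A ∪ B ∪ C ∪ D))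
      (fun j => decide (c (.inr j) ∈ A ∪ B ∪ C ∪ D)) (k5.trans (by omega))
    rw [bb_eq] at k6
    omega

end clusters

/-! ### The invariant and the strategy -/

open Classical in
/-- The number of ordered adjacent pairs in different parts of the partition given by `p`. -/
noncomputable def inter {V : Type*} [Fintype V] (G : SimpleGraph V) (p : V → V) : ℕ :=
  ∑ x : V × V, if G.Adj x.1 x.2 ∧ p x.1 ≠ p x.2 then 1 else 0

section invariant

set_option linter.unusedSectionVars false

variable {V : Type*} [Fintype V] [DecidableEq V] {G G' : SimpleGraph V}

/-- The part of `p` labelled `a`. -/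
def fiber (p : V → V) (a : V) : Finset V := Finset.univ.filter fun v => p v = a

theorem mem_fiber {p : V → V} {a v : V} : v ∈ fiber p a ↔ p v = a := by simp [fiber]

/-- The vertices are partitioned into duos with at most `m` edges between different parts. -/
def GInv (m : ℕ) (G : SimpleGraph V) : Prop :=
  (∀ v, deg G v ≤ 3) ∧ ∃ p : V → V, (∀ a, Duo G (fiber p a)) ∧ inter G p ≤ 2 * m

theorem deg_add {u v : V} (hu : deg G u < 3) (hv : deg G v < 3) (h : ∀ w, deg G w ≤ 3) (w : V) :
    deg (G ⊔ SimpleGraph.fromEdgeSet {s(u, v)}) w ≤ 3 := by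
  have key : ∀ z, (∀ y, (G ⊔ SimpleGraph.fromEdgeSet {s(u, v)}).Adj w y → G.Adj w y ∨ y = z) →
      deg (G ⊔ SimpleGraph.fromEdgeSet {s(u, v)}) w ≤ deg G w + 1 := by
    intro z hz
    unfold deg
    refine le_trans (Set.ncard_le_ncard (t := insert z (G.neighborSet w)) ?_ (Set.toFinite _))
      (Set.ncard_insert_le _ _)
    intro y hy
    rcases hz y hy with h | h
    · exact Or.inr h
    · exact Or.inl h
  by_cases h1 : w = u
  · subst h1
    have := key v (by
      intro y hy
      simp only [SimpleGraph.sup_adj, SimpleGraph.fromEdgeSet_adj, Set.mem_singleton_iff,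
        Sym2.eq_iff] at hy
      grind)
    omega
  by_cases h2 : w = v
  · subst h2
    have := key u (by
      intro y hy
      simp only [SimpleGraph.sup_adj, SimpleGraph.fromEdgeSet_adj, Set.mem_singleton_iff,
        Sym2.eq_iff] at hy
      grind)
    omega
  · have : deg (G ⊔ SimpleGraph.fromEdgeSet {s(u, v)}) w = deg G w := by
      unfold deg
      congr 1
      ext y
      simp only [SimpleGraph.mem_neighborSet, SimpleGraph.sup_adj, SimpleGraph.fromEdgeSet_adj,
        Set.mem_singleton_iff, Sym2.eq_iff]
      grind
    rw [this]
    exact h w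

theorem inter_add (p : V → V) (u v : V) :
    inter (G ⊔ SimpleGraph.fromEdgeSet {s(u, v)}) p ≤ inter G p + 2 := by
  classical
  have h1 : ∀ z : V × V, (∑ x : V × V, if x = z then 1 else 0) = 1 := by
    intro z
    simp
  have : inter G p + 2 = ∑ x : V × V, ((if G.Adj x.1 x.2 ∧ p x.1 ≠ p x.2 then 1 else 0) +
      (if x = (u, v) then 1 else 0) + (if x = (v, u) then 1 else 0)) := by
    rw [Finset.sum_add_distrib, Finset.sum_add_distrib, h1, h1, inter, add_assoc]
    congr!
  rw [this, inter]
  refine Finset.sum_le_sum fun x _ => ?_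
  obtain ⟨x, y⟩ := x
  simp only [SimpleGraph.sup_adj, SimpleGraph.fromEdgeSet_adj, Set.mem_singleton_iff, Sym2.eq_iff,
    Prod.mk.injEq]
  grind

theorem inter_add_same (p : V → V) {u v : V} (h : p u = p v) :
    inter (G ⊔ SimpleGraph.fromEdgeSet {s(u, v)}) p = inter G p := by
  classical
  rw [inter, inter]
  refine Finset.sum_congr rfl fun x _ => ?_
  obtain ⟨x, y⟩ := x
  simp only [SimpleGraph.sup_adj, SimpleGraph.fromEdgeSet_adj, Set.mem_singleton_iff, Sym2.eq_iff]
  grind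

theorem inter_fiber (p : V → V) (a : V) : 2 * ee G (fiber p a) (fiber p a)ᶜ ≤ inter G p := by
  classical
  rw [two_mul]
  nth_rewrite 2 [ee_comm]
  rw [ee, ee, inter, ← Finset.sum_add_distrib]
  refine Finset.sum_le_sum fun x _ => ?_
  simp only [Finset.mem_compl, mem_fiber]
  grind

theorem inter_two (p : V → V) {a b : V} (hab : a ≠ b) :
    2 * ee G (fiber p a) (fiber p b) +
      2 * ee G (fiber p a ∪ fiber p b) (fiber p a ∪ fiber p b)ᶜ ≤ inter G p := by
  classical
  rw [two_mul, two_mul]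
  nth_rewrite 2 [ee_comm]
  nth_rewrite 4 [ee_comm]
  rw [ee, ee, ee, ee, inter, ← Finset.sum_add_distrib, ← Finset.sum_add_distrib,
    ← Finset.sum_add_distrib]
  refine Finset.sum_le_sum fun x _ => ?_
  simp only [Finset.mem_compl, Finset.mem_union, mem_fiber]
  grind

/-- Merge part `b` into part `a`. -/
def merge (p : V → V) (a b : V) : V → V := fun v => if p v = b then a else p v

theorem inter_merge (p : V → V) {a b : V} (hab : a ≠ b) :
    inter G p = inter G (merge p a b) + 2 * ee G (fiber p a) (fiber p b) := by
  classical
  rw [two_mul]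
  nth_rewrite 2 [ee_comm]
  rw [ee, ee, inter, inter, ← Finset.sum_add_distrib, ← Finset.sum_add_distrib]
  refine Finset.sum_congr rfl fun x _ => ?_
  simp only [mem_fiber, merge]
  grind

theorem fiber_merge (p : V → V) {a b : V} (hab : a ≠ b) (d : V) :
    fiber (merge p a b) d =
      if d = a then fiber p a ∪ fiber p b else if d = b then ∅ else fiber p d := by
  ext v
  have : v ∈ fiber (merge p a b) d ↔ merge p a b v = d := mem_fiber
  rw [this, merge]
  split_ifs <;> simp only [Finset.mem_union, mem_fiber, Finset.notMem_empty] <;> grind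

theorem GInv.move {u v : V} (hu : deg G u < 3) (hv : deg G v < 3) (h : GInv 1 G) :
    GInv 2 (G ⊔ SimpleGraph.fromEdgeSet {s(u, v)}) := by
  obtain ⟨hd, p, hp, hi⟩ := h
  refine ⟨deg_add hu hv hd, p, fun a => (hp a).mono le_sup_left, ?_⟩
  have := inter_add (G := G) p u v
  omega

theorem GInv.mono {G : SimpleGraph V} (h : GInv 1 G) : GInv 2 G := by
  obtain ⟨hd, p, hp, hi⟩ := h
  exact ⟨hd, p, hp, by omega⟩

theorem GInv.bot : GInv 1 (⊥ : SimpleGraph V) := by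
  classical
  refine ⟨fun v => ?_, id, fun a => Or.inl ?_, ?_⟩
  · have : (⊥ : SimpleGraph V).neighborSet v = ∅ := by ext; simp
    simp [deg, this]
  · have : fiber id a = {a} := by ext; simp [mem_fiber]
    rw [this]
    exact .single a
  · simp [inter]

/-- The designated player can always restore the invariant. -/
theorem GInv.restore (h : GInv 2 G)
    (hm : ∃ u v, u ≠ v ∧ ¬ G.Adj u v ∧ deg G u < 3 ∧ deg G v < 3) :
    ∃ u v, u ≠ v ∧ ¬ G.Adj u v ∧ deg G u < 3 ∧ deg G v < 3 ∧
      GInv 1 (G ⊔ SimpleGraph.fromEdgeSet {s(u, v)}) := by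
  classical
  obtain ⟨hd, p, hp, hi⟩ := h
  induction hk : inter G p using Nat.strong_induction_on generalizing p with
  | _ k ih =>
  subst hk
  by_cases h0 : inter G p = 0
  · obtain ⟨u, v, hne, hna, hu, hv⟩ := hm
    refine ⟨u, v, hne, hna, hu, hv, deg_add hu hv hd, p, fun a => (hp a).mono le_sup_left, ?_⟩
    have := inter_add (G := G) p u v
    omega
  have hex : ∃ x y, G.Adj x y ∧ p x ≠ p y := by
    by_contra! hc
    apply h0
    rw [inter]
    refine Finset.sum_eq_zero fun x _ => ?_
    rw [if_neg]
    exact fun h => h.2 (hc _ _ h.1)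
  obtain ⟨x, y, hxy, hne⟩ := hex
  have he : 1 ≤ ee G (fiber p (p x)) (fiber p (p y)) :=
    ee_pos (mem_fiber.2 rfl) (mem_fiber.2 rfl) hxy
  generalize p x = a at hne he
  generalize p y = b at hne he
  have i1 := inter_two (G := G) p hne
  have i2 := inter_merge (G := G) p hne
  have hdis : Disjoint (fiber p a) (fiber p b) := by
    rw [Finset.disjoint_left]
    intro v h1 h2
    exact hne ((mem_fiber.1 h1).symm.trans (mem_fiber.1 h2))
  have hpart : ∀ G' : SimpleGraph V, G ≤ G' → Duo G' (fiber p a ∪ fiber p b) →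
      ∀ d, Duo G' (fiber (merge p a b) d) := by
    intro G' hle h d
    rw [fiber_merge p hne]
    split_ifs
    · exact h
    · exact Or.inl .empty
    · exact (hp d).mono hle
  rcases collapse (hp a) (hp b) hdis he (by omega) with hg | ⟨u, v, hu, hv, hne', hna, du, dv, hg⟩
  · exact ih _ (by omega) (merge p a b) (hpart G le_rfl hg) (by omega) rfl
  · refine ⟨u, v, hne', hna, du, dv, deg_add du dv hd, merge p a b, hpart _ le_sup_left hg, ?_⟩
    rw [inter_add_same]
    · omega
    · have h1 : u ∈ fiber (merge p a b) a := by rwa [fiber_merge p hne, if_pos rfl]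
      have h2 : v ∈ fiber (merge p a b) a := by rwa [fiber_merge p hne, if_pos rfl]
      rw [mem_fiber] at h1 h2
      rw [h1, h2]

theorem GInv.not_immersion (h : GInv 2 G) : ¬ Immersion G := by
  rintro ⟨c, E, hc, hE, hcr⟩
  obtain ⟨hd, p, hp, hi⟩ := h
  have hmem : c (.inl 0) ∈ fiber p (p (c (.inl 0))) := mem_fiber.2 rfl
  have hduo := hp (p (c (.inl 0)))
  have i1 := inter_fiber (G := G) p (p (c (.inl 0)))
  generalize fiber p (p (c (.inl 0))) = D at hmem hduo i1
  have k5 := cut_le hE hcr D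
  have k6 := cut_two (fun i => decide (c (.inl i) ∈ D))
    (fun j => decide (c (.inr j) ∈ D)) (k5.trans (by omega))
  rw [bb_eq] at k6
  have hpos : 1 ≤ bb c D := by
    unfold bb
    exact Finset.card_pos.2 ⟨.inl 0, by simpa using hmem⟩
  have hle : bb c D ≤ 2 := by
    rcases hduo with h | ⟨A, B, hA, hB, -, -, rfl⟩
    · have := h.bb_le hd hc hE hcr
      omega
    · have h1 := hA.bb_le hd hc hE hcr
      have h2 := hB.bb_le hd hc hE hcr
      have := bb_union c A B
      omega
  omega

end invariant

theorem GInv.of_gmove {n : ℕ} {G G' : SimpleGraph (Fin n)} (h : GInv 1 G) (hm : GMove 3 n G G') :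
    GInv 2 G' := by
  obtain ⟨u, v, -, -, hu, hv, rfl⟩ := hm
  exact h.move hu hv

theorem GInv.exists_gmove {n : ℕ} {G : SimpleGraph (Fin n)} (h : GInv 2 G)
    (hm : ∃ G', GMove 3 n G G') : ∃ G', GMove 3 n G G' ∧ GInv 1 G' := by
  obtain ⟨_, u, v, h1, h2, h3, h4, -⟩ := hm
  obtain ⟨u, v, h1, h2, h3, h4, h5⟩ := h.restore ⟨u, v, h1, h2, h3, h4⟩
  exact ⟨_, ⟨u, v, h1, h2, h3, h4, rfl⟩, h5⟩

/-- In the 3-regular graph game on `n` vertices, regardless of who has the first move,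
a player has a strategy ensuring that every terminal position is planar, i.e. has
neither a `K_5` minor nor a `K_{3,3}` minor. -/
theorem three_regular_game_planar (n : ℕ) (first : Bool) :
    ∃ σ : SimpleGraph (Fin n) → SimpleGraph (Fin n), IsStrategy 3 n σ ∧
      ∀ (f : ℕ → SimpleGraph (Fin n)) (T : ℕ), IsPlay 3 n σ first f T →
        ¬HasCliqueMinor (f T) 5 ∧ ¬HasK33Minor (f T) := by
  have hex : ∀ G : SimpleGraph (Fin n), ∃ G', (∃ G'', GMove 3 n G G'') →
      GMove 3 n G G' ∧ (GInv 2 G → GInv 1 G') := by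
    intro G
    by_cases hm : ∃ G'', GMove 3 n G G''
    · by_cases hI : GInv 2 G
      · obtain ⟨G', h1, h2⟩ := hI.exists_gmove hm
        exact ⟨G', fun _ => ⟨h1, fun _ => h2⟩⟩
      · obtain ⟨G', h1⟩ := hm
        exact ⟨G', fun _ => ⟨h1, fun h => absurd h hI⟩⟩
    · exact ⟨G, fun h => absurd h hm⟩
  choose σ hσ using hex
  refine ⟨σ, fun G h => (hσ G h).1, ?_⟩
  rintro f T ⟨h0, hmv, hst, -⟩
  have key : ∀ i ≤ T, GInv 2 (f i) ∧ (¬ ((i % 2 = 0) ↔ first = true) → GInv 1 (f i)) := by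
    intro i
    induction i with
    | zero =>
      intro _
      rw [h0]
      exact ⟨GInv.bot.mono, fun _ => GInv.bot⟩
    | succ i ih =>
      intro hi
      obtain ⟨a1, a2⟩ := ih (by omega)
      by_cases ht : (i % 2 = 0) ↔ first = true
      · have h1 : GInv 1 (f (i + 1)) := by
          rw [hst i (by omega) ht]
          exact (hσ (f i) ⟨_, hmv i (by omega)⟩).2 a1
        exact ⟨h1.mono, fun _ => h1⟩
      · refine ⟨(a2 ht).of_gmove (hmv i (by omega)), fun hc => ?_⟩
        exfalso
        have hpar : (i + 1) % 2 = 0 ↔ ¬ i % 2 = 0 := by omega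
        rw [hpar] at hc
        tauto
  have hT := (key T le_rfl).1
  exact ⟨fun h => hT.not_immersion (immersion_of_K5 hT.1 h),
    fun h => hT.not_immersion (immersion_of_K33 h)⟩
end

section
/- For every ℓ there exists N such that for all n ≥ N, in the 4-regular graph game on n vertices, regardless of who has the first move, one of the players has a strategy guaranteeing that every terminal position (the graph obtained when no legal move remains) contains a K_ℓ minor. -/
open Finset in
/-- Free slots at a vertex set. -/
noncomputable def slots {n : ℕ} (G : SimpleGraph (Fin n)) (S : Finset (Fin n)) : ℕ :=
  ∑ w ∈ S, (4 - deg G w)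

/-- Number of endpoints of the edge `uv` in `S`. -/
def tch {n : ℕ} (u v : Fin n) (S : Finset (Fin n)) : ℕ :=
  (if u ∈ S then 1 else 0) + (if v ∈ S then 1 else 0)

def Conn {n : ℕ} (G : SimpleGraph (Fin n)) (S : Finset (Fin n)) : Prop :=
  (G.induce (S : Set (Fin n))).Connected

/-- Adding one edge. -/
def EMove {n : ℕ} (u v : Fin n) (G G' : SimpleGraph (Fin n)) : Prop :=
  u ≠ v ∧ ¬G.Adj u v ∧ deg G u < 4 ∧ deg G v < 4 ∧
    G' = G ⊔ SimpleGraph.fromEdgeSet {s(u, v)}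

lemma EMove.gmove {n : ℕ} {u v : Fin n} {G G' : SimpleGraph (Fin n)} (h : EMove u v G G') :
    GMove 4 n G G' := ⟨u, v, h⟩

lemma EMove.le {n : ℕ} {u v : Fin n} {G G' : SimpleGraph (Fin n)} (h : EMove u v G G') :
    G ≤ G' := by
  rw [h.2.2.2.2]; exact le_sup_left

lemma EMove.adj {n : ℕ} {u v : Fin n} {G G' : SimpleGraph (Fin n)} (h : EMove u v G G') :
    G'.Adj u v := by
  rw [h.2.2.2.2]; right; simp [h.1]

lemma EMove.deg_eq {n : ℕ} {u v : Fin n} {G G' : SimpleGraph (Fin n)} (h : EMove u v G G')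
    (w : Fin n) : deg G' w = deg G w + ((if w = u then 1 else 0) + (if w = v then 1 else 0)) := by
  obtain ⟨huv, hna, -, -, rfl⟩ := h
  unfold deg
  by_cases hu : w = u
  · subst hu
    have : (G ⊔ SimpleGraph.fromEdgeSet {s(w, v)}).neighborSet w = insert v (G.neighborSet w) := by
      ext x
      simp only [SimpleGraph.mem_neighborSet, SimpleGraph.sup_adj, SimpleGraph.fromEdgeSet_adj,
        Set.mem_singleton_iff, Sym2.eq_iff, Set.mem_insert_iff]
      grind
    rw [this, Set.ncard_insert_of_notMem (by simpa using hna) (Set.toFinite _)]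
    simp [huv]
  · by_cases hv : w = v
    · subst hv
      have : (G ⊔ SimpleGraph.fromEdgeSet {s(u, w)}).neighborSet w
          = insert u (G.neighborSet w) := by
        ext x
        simp only [SimpleGraph.mem_neighborSet, SimpleGraph.sup_adj, SimpleGraph.fromEdgeSet_adj,
          Set.mem_singleton_iff, Sym2.eq_iff, Set.mem_insert_iff]
        grind
      rw [this, Set.ncard_insert_of_notMem (by simpa [SimpleGraph.adj_comm] using hna)
        (Set.toFinite _)]
      simp [hu]
    · have : (G ⊔ SimpleGraph.fromEdgeSet {s(u, v)}).neighborSet w = G.neighborSet w := by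
        ext x
        simp only [SimpleGraph.mem_neighborSet, SimpleGraph.sup_adj, SimpleGraph.fromEdgeSet_adj,
          Set.mem_singleton_iff, Sym2.eq_iff]
        grind
      rw [this]; simp [hu, hv]

lemma EMove.slots_eq {n : ℕ} {u v : Fin n} {G G' : SimpleGraph (Fin n)} (h : EMove u v G G')
    (S : Finset (Fin n)) : slots G S = slots G' S + tch u v S := by
  have h1 : ∀ w ∈ S, 4 - deg G w = (4 - deg G' w) +
      ((if w = u then 1 else 0) + (if w = v then 1 else 0)) := by
    intro w _
    have h2 := h.deg_eq w
    obtain ⟨huv, -, hu, hv, -⟩ := h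
    rw [h2]
    split_ifs with a b b
    · exact absurd (a.symm.trans b) huv
    · subst a; omega
    · subst b; omega
    · omega
  unfold slots tch
  rw [Finset.sum_congr rfl h1, Finset.sum_add_distrib, Finset.sum_add_distrib]
  simp

lemma exists_free {n : ℕ} {G : SimpleGraph (Fin n)} {S : Finset (Fin n)} (h : 0 < slots G S) :
    ∃ u ∈ S, deg G u < 4 := by
  by_contra! hc
  have : slots G S = 0 := by
    unfold slots
    exact Finset.sum_eq_zero fun w hw => by have := hc w hw; omega
  omega

lemma slots_union {n : ℕ} (G : SimpleGraph (Fin n)) {S T : Finset (Fin n)} (h : Disjoint S T) :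
    slots G (S ∪ T) = slots G S + slots G T := Finset.sum_union h

lemma slots_le {n : ℕ} (G : SimpleGraph (Fin n)) (S : Finset (Fin n)) :
    slots G S ≤ 4 * S.card := by
  unfold slots
  calc _ ≤ ∑ w ∈ S, 4 := Finset.sum_le_sum fun _ _ => by omega
    _ = _ := by simp [mul_comm]

lemma Conn.mono {n : ℕ} {G G' : SimpleGraph (Fin n)} {S : Finset (Fin n)} (h : Conn G S)
    (hle : G ≤ G') : Conn G' S :=
  SimpleGraph.Connected.mono (SimpleGraph.comap_monotone _ hle) h

lemma Conn.union {n : ℕ} {G : SimpleGraph (Fin n)} {S T : Finset (Fin n)} (h : Conn G S)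
    (h' : Conn G T) {u v : Fin n} (hu : u ∈ S) (hv : v ∈ T) (ha : G.Adj u v) :
    Conn G (S ∪ T) := by
  unfold Conn
  rw [Finset.coe_union]
  exact SimpleGraph.connected_induce_union h.preconnected h'.preconnected
    (by simpa using hu) (by simpa using hv) ha

/-- Pairwise disjoint family of vertex sets. -/
def PD {n : ℕ} (F : Finset (Finset (Fin n))) : Prop :=
  ∀ S ∈ F, ∀ T ∈ F, S ≠ T → Disjoint S T

lemma PD.subset {n : ℕ} {F F' : Finset (Finset (Fin n))} (h : PD F) (hs : F' ⊆ F) : PD F' :=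
  fun S hS T hT => h S (hs hS) T (hs hT)

lemma PD.sum_ind {n : ℕ} {F : Finset (Finset (Fin n))} (h : PD F) (u : Fin n)
    (c : Finset (Fin n) → ℕ) (k : ℕ) (hc : ∀ S ∈ F, u ∈ S → c S ≤ k) :
    ∑ S ∈ F, c S * (if u ∈ S then 1 else 0) ≤ k := by
  by_cases hex : ∃ S ∈ F, u ∈ S
  · obtain ⟨S, hS, hu⟩ := hex
    rw [Finset.sum_eq_single S]
    · simpa [hu] using hc S hS hu
    · intro T hT hne
      have := h T hT S hS hne
      have : u ∉ T := fun hh => Finset.disjoint_left.mp this hh hu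
      simp [this]
    · intro h; exact absurd hS h
  · push Not at hex
    rw [Finset.sum_eq_zero]
    · omega
    · intro S hS; simp [hex S hS]

lemma PD.sum_tch {n : ℕ} {F : Finset (Finset (Fin n))} (h : PD F) (u v : Fin n) :
    ∑ S ∈ F, tch u v S ≤ 2 := by
  have h1 := h.sum_ind u (fun _ => 1) 1 (by simp)
  have h2 := h.sum_ind v (fun _ => 1) 1 (by simp)
  simp only [one_mul] at h1 h2
  unfold tch
  rw [Finset.sum_add_distrib]; omega

/-- Maker (to move) can force reaching `Q`, the opponent being allowed to pass. -/
inductive MWin {n : ℕ} (Q : SimpleGraph (Fin n) → Prop) : SimpleGraph (Fin n) → Prop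
  | done (G : SimpleGraph (Fin n)) : Q G → MWin Q G
  | step (G G' : SimpleGraph (Fin n)) : GMove 4 n G G' →
      (∀ G'', (GMove 4 n G' G'' ∨ G'' = G') → MWin Q G'') → MWin Q G

lemma MWin.trans {n : ℕ} {Q Q' : SimpleGraph (Fin n) → Prop} {G : SimpleGraph (Fin n)}
    (h : MWin Q G) (hQ : ∀ G, Q G → MWin Q' G) : MWin Q' G := by
  induction h with
  | done G h => exact hQ G h
  | step G G' hm _ ih => exact MWin.step G G' hm ih

lemma breaker_step {n : ℕ} {G G' : SimpleGraph (Fin n)} (h : GMove 4 n G G' ∨ G' = G) :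
    G ≤ G' ∧ ∃ t : Finset (Fin n) → ℕ, (∀ S, slots G S ≤ slots G' S + t S) ∧
      ∀ F, PD F → ∑ S ∈ F, t S ≤ 2 := by
  rcases h with ⟨u, v, h⟩ | rfl
  · have h : EMove u v G G' := h
    exact ⟨h.le, tch u v, fun S => (h.slots_eq S).le, fun F hF => hF.sum_tch u v⟩
  · exact ⟨le_rfl, fun _ => 0, by simp, by simp⟩

/-- Many disjoint connected sets with at least `s` free slots each. -/
def Has {n : ℕ} (A s : ℕ) (G : SimpleGraph (Fin n)) : Prop :=
  ∃ F : Finset (Finset (Fin n)), PD F ∧ A ≤ F.card ∧ ∀ S ∈ F, Conn G S ∧ s ≤ slots G S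

/-- Final phase. -/
lemma final_phase {n l : ℕ} (B : Fin l → Finset (Fin n))
    (hd : ∀ i j, i ≠ j → Disjoint (B i) (B j)) (k : ℕ) :
    ∀ (G : SimpleGraph (Fin n)) (P : Finset (Fin l × Fin l)), P.card ≤ k →
      (∀ i, Conn G (B i)) → (∀ i, 4 * k ≤ slots G (B i)) →
      (∀ i j, i ≠ j → (i, j) ∉ P → ∃ u ∈ B i, ∃ v ∈ B j, G.Adj u v) →
      MWin (fun G => HasCliqueMinor G l) G := by
  induction k with
  | zero =>
    intro G P hP hc _ ha
    have hP0 : P = ∅ := by simpa using hP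
    subst hP0
    refine MWin.done _ ⟨fun i => (B i : Set (Fin n)), ?_, hc, ?_, ?_⟩
    · intro i
      obtain ⟨x⟩ := (hc i).nonempty
      exact ⟨x.1, x.2⟩
    · intro i j hij
      exact Finset.disjoint_coe.mpr (hd i j hij)
    · intro i j hij
      simpa using ha i j hij (by simp)
  | succ k ih =>
    intro G P hP hc hs ha
    by_cases hex : ∃ p ∈ P, p.1 ≠ p.2 ∧ ¬ ∃ u ∈ B p.1, ∃ v ∈ B p.2, G.Adj u v
    · obtain ⟨⟨i, j⟩, hp, hij, hno⟩ := hex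
      simp only at hij hno
      obtain ⟨u, hu, hud⟩ := exists_free (G := G) (S := B i) (by have := hs i; omega)
      obtain ⟨v, hv, hvd⟩ := exists_free (G := G) (S := B j) (by have := hs j; omega)
      have huv : u ≠ v := fun h => Finset.disjoint_left.mp (hd i j hij) hu (h ▸ hv)
      have hm : EMove u v G (G ⊔ SimpleGraph.fromEdgeSet {s(u, v)}) :=
        ⟨huv, fun h => hno ⟨u, hu, v, hv, h⟩, hud, hvd, rfl⟩
      refine MWin.step _ _ hm.gmove fun G'' hG'' => ?_
      obtain ⟨hle, t, ht, ht2⟩ := breaker_step hG''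
      refine ih G'' (P.erase (i, j)) ?_ (fun i => ((hc i).mono hm.le).mono hle) ?_ ?_
      · rw [Finset.card_erase_of_mem hp]; omega
      · intro a
        have h1 := ht (B a)
        have h2 := ht2 {B a} (by intro S hS T hT; simp_all)
        have h3 := hm.slots_eq (B a)
        have h4 := hs a
        have h5 : tch u v (B a) ≤ 2 := by unfold tch; split_ifs <;> omega
        simp only [Finset.sum_singleton] at h2
        have h6 : ¬ (u ∈ B a ∧ v ∈ B a) := by
          rintro ⟨h, h'⟩
          by_cases hai : a = i
          · subst hai; exact Finset.disjoint_left.mp (hd _ _ hij) h' hv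
          · exact Finset.disjoint_left.mp (hd _ _ hai) h hu
        have h7 : tch u v (B a) ≤ 1 := by
          unfold tch; split_ifs <;> simp_all
        omega
      · intro a b hab hnp
        by_cases he : (a, b) = (i, j)
        · obtain ⟨rfl, rfl⟩ := Prod.mk.inj he
          exact ⟨u, hu, v, hv, hle hm.adj⟩
        · obtain ⟨x, hx, y, hy, hxy⟩ := ha a b hab (fun h => hnp (Finset.mem_erase.mpr ⟨he, h⟩))
          exact ⟨x, hx, y, hy, hle (hm.le hxy)⟩
    · push Not at hex
      refine ih G ∅ (by simp) hc (fun i => by have := hs i; omega) ?_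
      intro i j hij _
      by_cases hp : (i, j) ∈ P
      · exact hex _ hp hij
      · exact ha i j hij hp

lemma has_final {n l : ℕ} (G : SimpleGraph (Fin n)) (h : Has l (4 * (l * l)) G) :
    MWin (fun G => HasCliqueMinor G l) G := by
  obtain ⟨F, hF, hcard, hS⟩ := h
  obtain ⟨e⟩ : Nonempty (Fin l ↪ F) :=
    Function.Embedding.nonempty_of_card_le (by simpa using hcard)
  refine final_phase (fun i => (e i).1) ?_ (l * l) G Finset.univ (by simp)
    (fun i => (hS _ (e i).2).1) (fun i => (hS _ (e i).2).2) (by simp)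
  intro i j hij
  exact hF _ (e i).2 _ (e j).2 fun h => hij (e.injective (Subtype.ext h))

/-- Growth phase. -/
lemma growth_phase {n s A : ℕ} (hs : 5 ≤ s) (m : ℕ) :
    ∀ (G : SimpleGraph (Fin n)) (U M : Finset (Finset (Fin n))), U.card ≤ m → PD (U ∪ M) →
      Disjoint U M → (∀ S ∈ U, Conn G S ∧ s ≤ slots G S) → (∀ S ∈ M, Conn G S) →
      6 * A + 1 ≤ 2 * ∑ S ∈ M, min 3 (slots G S - s) + U.card →
      MWin (Has A (s + 1)) G := by
  induction m using Nat.strong_induction_on with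
  | _ m ih =>
  intro G U M hUm hPD hUM hU hM hK
  by_cases hU2 : U.card ≤ 1
  · refine MWin.done _ ⟨M.filter (fun S => s + 1 ≤ slots G S),
      hPD.subset ((Finset.filter_subset _ _).trans Finset.subset_union_right), ?_, ?_⟩
    · have h1 : ∑ S ∈ M, min 3 (slots G S - s)
          ≤ ∑ S ∈ M, if s + 1 ≤ slots G S then 3 else 0 := by
        refine Finset.sum_le_sum fun S _ => ?_
        split_ifs <;> omega
      rw [← Finset.sum_filter, Finset.sum_const, smul_eq_mul] at h1
      omega
    · intro S hS
      rw [Finset.mem_filter] at hS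
      exact ⟨hM S hS.1, hS.2⟩
  · obtain ⟨S, hS, T, hT, hST⟩ := Finset.one_lt_card.mp (by omega : 1 < U.card)
    have hdST : Disjoint S T := hPD S (by simp [hS]) T (by simp [hT]) hST
    obtain ⟨u, hu, hud⟩ := exists_free (G := G) (S := S) (by have := (hU S hS).2; omega)
    obtain ⟨v, hv, hvd⟩ := exists_free (G := G) (S := T) (by have := (hU T hT).2; omega)
    have huv : u ≠ v := fun h => Finset.disjoint_left.mp hdST hu (h ▸ hv)
    -- new families
    set U1 := (U.erase S).erase T with hU1
    set M1 := insert (S ∪ T) M with hM1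
    have hU1c : U1.card + 2 = U.card := by
      rw [hU1, Finset.card_erase_of_mem (by simp [hT, hST.symm]), Finset.card_erase_of_mem hS]
      omega
    have hU1s : ∀ R ∈ U1, R ∈ U ∧ R ≠ S ∧ R ≠ T := by
      intro R hR; simp [hU1] at hR; tauto
    have hdis : ∀ R ∈ U1 ∪ M, Disjoint R (S ∪ T) := by
      intro R hR
      have hRS : R ≠ S ∧ R ≠ T ∧ R ∈ U ∪ M := by
        rcases Finset.mem_union.mp hR with h | h
        · have := hU1s R h; simp [this]
        · refine ⟨?_, ?_, by simp [h]⟩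
          · rintro rfl; exact Finset.disjoint_left.mp hUM hS h
          · rintro rfl; exact Finset.disjoint_left.mp hUM hT h
      rw [Finset.disjoint_union_right]
      exact ⟨hPD R hRS.2.2 S (by simp [hS]) hRS.1, hPD R hRS.2.2 T (by simp [hT]) hRS.2.1⟩
    have hSTn : S ∪ T ∉ U1 ∪ M := by
      intro h
      have := hdis _ h
      rw [disjoint_self] at this
      have : u ∈ (⊥ : Finset (Fin n)) := this ▸ Finset.mem_union_left _ hu
      simp at this
    have hSTU : S ∪ T ∉ U1 := fun h => hSTn (Finset.mem_union_left _ h)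
    have hSTM : S ∪ T ∉ M := fun h => hSTn (Finset.mem_union_right _ h)
    have hsub : U1 ∪ M ⊆ U ∪ M := Finset.union_subset_union_left
      ((Finset.erase_subset _ _).trans (Finset.erase_subset _ _))
    have hPD1 : PD (U1 ∪ M1) := by
      have he : U1 ∪ M1 = insert (S ∪ T) (U1 ∪ M) := by rw [hM1, Finset.union_insert]
      rw [he]
      intro R hR R' hR' hne
      rcases Finset.mem_insert.mp hR with rfl | hR
      · rcases Finset.mem_insert.mp hR' with rfl | hR'
        · exact absurd rfl hne
        · exact (hdis _ hR').symm
      · rcases Finset.mem_insert.mp hR' with rfl | hR'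
        · exact hdis _ hR
        · exact hPD _ (hsub hR) _ (hsub hR') hne
    have hUM1 : Disjoint U1 M1 := by
      rw [hM1, Finset.disjoint_insert_right]
      exact ⟨hSTU, hUM.mono_left ((Finset.erase_subset _ _).trans (Finset.erase_subset _ _))⟩
    have hsl := slots_union G hdST
    have hsS := (hU S hS).2
    have hsT := (hU T hT).2
    by_cases hadj : G.Adj u v
    · refine ih U1.card (by omega) G U1 M1 le_rfl hPD1 hUM1 (fun R hR => hU R (hU1s R hR).1) ?_ ?_
      · intro R hR
        rcases Finset.mem_insert.mp hR with rfl | hR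
        · exact (hU S hS).1.union (hU T hT).1 hu hv hadj
        · exact hM R hR
      · rw [hM1, Finset.sum_insert hSTM]
        omega
    · have hm : EMove u v G (G ⊔ SimpleGraph.fromEdgeSet {s(u, v)}) :=
        ⟨huv, hadj, hud, hvd, rfl⟩
      refine MWin.step _ _ hm.gmove fun G'' hG'' => ?_
      obtain ⟨hle, t, ht, ht2⟩ := breaker_step hG''
      have htch : ∀ R ∈ U1 ∪ M, tch u v R = 0 := by
        intro R hR
        have h1 := Finset.disjoint_right.mp (hdis R hR) (Finset.mem_union_left T hu)
        have h2 := Finset.disjoint_right.mp (hdis R hR) (Finset.mem_union_right S hv)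
        simp [tch, h1, h2]
      have hR : ∀ R ∈ U1 ∪ M, slots G R ≤ slots G'' R + t R := by
        intro R hR
        have h1 := hm.slots_eq R
        have h2 := ht R
        have h3 := htch R hR
        omega
      have hSTs : slots G (S ∪ T) ≤ slots G'' (S ∪ T) + t (S ∪ T) + 2 := by
        have h1 := hm.slots_eq (S ∪ T)
        have h2 := ht (S ∪ T)
        have h3 : tch u v (S ∪ T) ≤ 2 := by unfold tch; split_ifs <;> omega
        omega
      have htot := ht2 _ hPD1
      rw [Finset.sum_union hUM1, hM1, Finset.sum_insert hSTM] at htot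
      have hUf : U1.card ≤ (U1.filter (fun R => s ≤ slots G'' R)).card + ∑ R ∈ U1, t R := by
        have : ∑ R ∈ U1, 1 ≤ ∑ R ∈ U1, ((if s ≤ slots G'' R then 1 else 0) + t R) := by
          refine Finset.sum_le_sum fun R hRU => ?_
          have h1 := hR R (Finset.mem_union_left _ hRU)
          have h2 := (hU R (hU1s R hRU).1).2
          split_ifs <;> omega
        rw [Finset.sum_add_distrib, ← Finset.card_filter] at this
        simpa using this
      have hMf : ∑ R ∈ M, min 3 (slots G R - s) ≤
          ∑ R ∈ M, min 3 (slots G'' R - s) + ∑ R ∈ M, t R := by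
        rw [← Finset.sum_add_distrib]
        refine Finset.sum_le_sum fun R hRM => ?_
        have h1 := hR R (Finset.mem_union_right _ hRM)
        omega
      have hfs : U1.filter (fun R => s ≤ slots G'' R) ⊆ U1 := Finset.filter_subset _ _
      have hfc := Finset.card_le_card hfs
      refine ih U1.card (by omega) G'' (U1.filter (fun R => s ≤ slots G'' R)) M1 hfc
        (hPD1.subset (Finset.union_subset_union_left hfs)) (hUM1.mono_left hfs) ?_ ?_ ?_
      · intro R hR
        rw [Finset.mem_filter] at hR
        exact ⟨((hU R (hU1s R hR.1).1).1.mono hm.le).mono hle, hR.2⟩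
      · intro R hR
        rcases Finset.mem_insert.mp hR with rfl | hR
        · exact (((hU S hS).1.mono hm.le).union ((hU T hT).1.mono hm.le) hu hv hm.adj).mono hle
        · exact ((hM R hR).mono hm.le).mono hle
      · rw [hM1, Finset.sum_insert hSTM]
        omega

lemma growth (A d : ℕ) : ∃ A0 : ℕ, ∀ (n : ℕ) (G : SimpleGraph (Fin n)), Has A0 5 G →
    MWin (Has A (5 + d)) G := by
  induction d generalizing A with
  | zero => exact ⟨A, fun n G h => MWin.done _ h⟩
  | succ d ih =>
    obtain ⟨A0, h0⟩ := ih (6 * A + 1)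
    refine ⟨A0, fun n G h => (h0 n G h).trans fun G' hG' => ?_⟩
    obtain ⟨F, hF, hc, hS⟩ := hG'
    exact growth_phase (s := 5 + d) (by omega) F.card G' F ∅ le_rfl (by simpa using hF) (by simp) hS (by simp)
      (by simpa using hc)

/-- Weight used in the opening phase. -/
noncomputable def wt {n : ℕ} (G : SimpleGraph (Fin n)) (S : Finset (Fin n)) : ℤ :=
  (if S.card = 2 then 2 else 1) * ((slots G S : ℤ) - 4)

/-- Invariant of the opening phase. -/
structure OInv {n : ℕ} (G : SimpleGraph (Fin n)) (F : Finset (Finset (Fin n)))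
    (X : Finset (Fin n)) : Prop where
  pd : PD F
  conn : ∀ S ∈ F, Conn G S
  card : ∀ S ∈ F, S.card = 2 ∨ S.card = 4
  clique : ∀ S ∈ F, S.card = 2 → (∀ a ∈ S, ∀ b ∈ S, a ≠ b → G.Adj a b) ∧ slots G S ≤ 6
  fresh : ∀ x ∈ X, deg G x = 0
  disj : ∀ S ∈ F, Disjoint S X

lemma opening_maker {n : ℕ} {G : SimpleGraph (Fin n)} {F : Finset (Finset (Fin n))}
    {X : Finset (Fin n)} (h : OInv G F X) (hX : 2 ≤ X.card) :
    ∃ G' F' X', GMove 4 n G G' ∧ OInv G' F' X' ∧ X.card ≤ X'.card + 2 ∧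
      ∑ S ∈ F, wt G S + 4 ≤ ∑ S ∈ F', wt G' S := by
  obtain ⟨a, ha, b, hb, hab⟩ := Finset.one_lt_card.mp (by omega : 1 < X.card)
  have hda := h.fresh a ha
  have hdb := h.fresh b hb
  have hna : ¬ G.Adj a b := by
    intro hadj
    have : G.neighborSet a = ∅ := (Set.ncard_eq_zero (Set.toFinite _)).mp hda
    have h2 : b ∈ G.neighborSet a := hadj
    rw [this] at h2; exact h2
  have hm : EMove a b G (G ⊔ SimpleGraph.fromEdgeSet {s(a, b)}) :=
    ⟨hab, hna, by omega, by omega, rfl⟩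
  set G' := G ⊔ SimpleGraph.fromEdgeSet {s(a, b)} with hG'
  have hout : ∀ S ∈ F, a ∉ S ∧ b ∉ S := fun S hS =>
    ⟨fun hh => Finset.disjoint_left.mp (h.disj S hS) hh ha,
     fun hh => Finset.disjoint_left.mp (h.disj S hS) hh hb⟩
  have hslF : ∀ S ∈ F, slots G' S = slots G S := by
    intro S hS
    have := hm.slots_eq S
    simp [tch, hout S hS] at this
    exact this.symm
  have hsl : slots G' {a, b} = 6 := by
    have h1 := hm.slots_eq {a, b}
    have h2 : slots G {a, b} = 8 := by
      unfold slots; rw [Finset.sum_pair hab, hda, hdb]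
    simp [tch] at h1
    omega
  have hnew : ({a, b} : Finset (Fin n)) ∉ F := fun hh => (hout _ hh).1 (by simp)
  have hdn : ∀ S ∈ F, Disjoint S {a, b} := by
    intro S hS
    rw [Finset.disjoint_insert_right, Finset.disjoint_singleton_right]
    exact hout S hS
  refine ⟨G', insert {a, b} F, X \ {a, b}, hm.gmove, ?_, ?_, ?_⟩
  · constructor
    · intro R hR R' hR' hne
      rcases Finset.mem_insert.mp hR with rfl | hR
      · rcases Finset.mem_insert.mp hR' with rfl | hR'
        · exact absurd rfl hne
        · exact (hdn _ hR').symm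
      · rcases Finset.mem_insert.mp hR' with rfl | hR'
        · exact hdn _ hR
        · exact h.pd _ hR _ hR' hne
    · intro S hS
      rcases Finset.mem_insert.mp hS with rfl | hS
      · unfold Conn
        rw [Finset.coe_pair]
        exact SimpleGraph.induce_pair_connected_of_adj hm.adj
      · exact (h.conn S hS).mono hm.le
    · intro S hS
      rcases Finset.mem_insert.mp hS with rfl | hS
      · left; exact Finset.card_pair hab
      · exact h.card S hS
    · intro S hS hc
      rcases Finset.mem_insert.mp hS with rfl | hS
      · refine ⟨?_, hsl.le⟩
        have := hm.adj
        have h2 := this.symm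
        intro x hx y hy hxy
        simp only [Finset.mem_insert, Finset.mem_singleton] at hx hy
        rcases hx with rfl | rfl <;> rcases hy with rfl | rfl <;> tauto
      · refine ⟨fun x hx y hy hxy => hm.le ((h.clique S hS hc).1 x hx y hy hxy), ?_⟩
        rw [hslF S hS]; exact (h.clique S hS hc).2
    · intro x hx
      simp only [Finset.mem_sdiff, Finset.mem_insert, Finset.mem_singleton, not_or] at hx
      rw [hm.deg_eq x, h.fresh x hx.1]; simp [hx.2]
    · intro S hS
      rcases Finset.mem_insert.mp hS with rfl | hS
      · exact Finset.disjoint_sdiff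
      · exact (h.disj S hS).mono_right Finset.sdiff_subset
  · have h1 := Finset.card_le_card_sdiff_add_card (s := X) (t := {a, b})
    have h2 := Finset.card_pair hab
    omega
  · rw [Finset.sum_insert hnew]
    have h1 : ∑ S ∈ F, wt G' S = ∑ S ∈ F, wt G S :=
      Finset.sum_congr rfl fun S hS => by unfold wt; rw [hslF S hS]
    rw [h1]
    have h2 : wt G' {a, b} = 4 := by
      unfold wt; rw [hsl, Finset.card_pair hab]; norm_num
    rw [h2]; omega

lemma opening_breaker {n : ℕ} {G G' : SimpleGraph (Fin n)} {F : Finset (Finset (Fin n))}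
    {X : Finset (Fin n)} (h : OInv G F X) (hG : GMove 4 n G G' ∨ G' = G) :
    ∃ F' X', OInv G' F' X' ∧ X.card ≤ X'.card + 2 ∧
      ∑ S ∈ F, wt G S ≤ ∑ S ∈ F', wt G' S + 3 := by
  rcases hG with ⟨u, v, hm⟩ | rfl
  swap
  · exact ⟨F, X, h, by omega, by omega⟩
  have hm : EMove u v G G' := hm
  have hXc : X.card ≤ (X \ {u, v}).card + 2 := by
    have h1 := Finset.card_le_card_sdiff_add_card (s := X) (t := {u, v})
    have h2 := Finset.card_pair hm.1
    omega
  have hfr : ∀ x ∈ X \ {u, v}, deg G' x = 0 := by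
    intro x hx
    simp only [Finset.mem_sdiff, Finset.mem_insert, Finset.mem_singleton, not_or] at hx
    rw [hm.deg_eq x, h.fresh x hx.1]; simp [hx.2]
  have hcl : ∀ S ∈ F, S.card = 2 →
      (∀ a ∈ S, ∀ b ∈ S, a ≠ b → G'.Adj a b) ∧ slots G' S ≤ 6 := by
    intro S hS hc
    refine ⟨fun x hx y hy hxy => hm.le ((h.clique S hS hc).1 x hx y hy hxy), ?_⟩
    have h1 := (h.clique S hS hc).2
    have h2 := hm.slots_eq S
    omega
  by_cases hpp : (∃ S ∈ F, S.card = 2 ∧ u ∈ S) ∧ (∃ T ∈ F, T.card = 2 ∧ v ∈ T)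
  · obtain ⟨⟨S, hS, hSc, hu⟩, ⟨T, hT, hTc, hv⟩⟩ := hpp
    have hST : S ≠ T := by
      rintro rfl
      exact hm.2.1 ((h.clique S hS hSc).1 u hu v hv hm.1)
    have hdST : Disjoint S T := h.pd S hS T hT hST
    set F1 := (F.erase S).erase T with hF1
    have hF1s : ∀ R ∈ F1, R ∈ F ∧ R ≠ S ∧ R ≠ T := by
      intro R hR; simp [hF1] at hR; tauto
    have hdis : ∀ R ∈ F1, Disjoint R (S ∪ T) := by
      intro R hR
      have := hF1s R hR
      rw [Finset.disjoint_union_right]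
      exact ⟨h.pd R this.1 S hS this.2.1, h.pd R this.1 T hT this.2.2⟩
    have hSTn : S ∪ T ∉ F1 := by
      intro hh
      have := hdis _ hh
      rw [disjoint_self] at this
      have : u ∈ (⊥ : Finset (Fin n)) := this ▸ Finset.mem_union_left _ hu
      simp at this
    have hSTc : (S ∪ T).card = 4 := by
      rw [Finset.card_union_of_disjoint hdST]; omega
    refine ⟨insert (S ∪ T) F1, X \ {u, v}, ?_, hXc, ?_⟩
    · constructor
      · intro R hR R' hR' hne
        rcases Finset.mem_insert.mp hR with rfl | hR
        · rcases Finset.mem_insert.mp hR' with rfl | hR'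
          · exact absurd rfl hne
          · exact (hdis _ hR').symm
        · rcases Finset.mem_insert.mp hR' with rfl | hR'
          · exact hdis _ hR
          · exact h.pd _ (hF1s _ hR).1 _ (hF1s _ hR').1 hne
      · intro R hR
        rcases Finset.mem_insert.mp hR with rfl | hR
        · exact ((h.conn S hS).mono hm.le).union ((h.conn T hT).mono hm.le) hu hv hm.adj
        · exact (h.conn R (hF1s R hR).1).mono hm.le
      · intro R hR
        rcases Finset.mem_insert.mp hR with rfl | hR
        · right; exact hSTc
        · exact h.card R (hF1s R hR).1
      · intro R hR hc
        rcases Finset.mem_insert.mp hR with rfl | hR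
        · omega
        · exact hcl R (hF1s R hR).1 hc
      · exact hfr
      · intro R hR
        rcases Finset.mem_insert.mp hR with rfl | hR
        · rw [Finset.disjoint_union_left]
          exact ⟨(h.disj S hS).mono_right Finset.sdiff_subset,
            (h.disj T hT).mono_right Finset.sdiff_subset⟩
        · exact (h.disj R (hF1s R hR).1).mono_right Finset.sdiff_subset
    · rw [Finset.sum_insert hSTn, ← Finset.add_sum_erase F _ hS,
        ← Finset.add_sum_erase (F.erase S) _ (Finset.mem_erase.mpr ⟨hST.symm, hT⟩)]
      have h1 : ∑ R ∈ F1, wt G' R = ∑ R ∈ F1, wt G R := by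
        refine Finset.sum_congr rfl fun R hR => ?_
        have h1 := Finset.disjoint_right.mp (hdis R hR) (Finset.mem_union_left T hu)
        have h2 := Finset.disjoint_right.mp (hdis R hR) (Finset.mem_union_right S hv)
        have h3 := hm.slots_eq R
        simp [tch, h1, h2] at h3
        unfold wt; rw [h3]
      rw [h1]
      have h2 := hm.slots_eq (S ∪ T)
      rw [slots_union G hdST] at h2
      simp [tch, hu, hv] at h2
      have h3 := (h.clique S hS hSc).2
      have h4 := (h.clique T hT hTc).2
      have h5 : wt G S = 2 * ((slots G S : ℤ) - 4) := by simp [wt, hSc]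
      have h6 : wt G T = 2 * ((slots G T : ℤ) - 4) := by simp [wt, hTc]
      have h7 : wt G' (S ∪ T) = (slots G' (S ∪ T) : ℤ) - 4 := by simp [wt, hSTc]
      rw [h5, h6, h7]
      have h8 : ∑ x ∈ (F.erase S).erase T, wt G x = ∑ R ∈ F1, wt G R := rfl
      rw [h8]
      omega
  · refine ⟨F, X \ {u, v}, ?_, hXc, ?_⟩
    · exact ⟨h.pd, fun S hS => (h.conn S hS).mono hm.le, h.card, hcl, hfr,
        fun S hS => (h.disj S hS).mono_right Finset.sdiff_subset⟩
    · let c : Finset (Fin n) → ℕ := fun S => if S.card = 2 then 2 else 1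
      have hw : ∀ S, wt G S = wt G' S + ((c S * (if u ∈ S then 1 else 0) +
          c S * (if v ∈ S then 1 else 0) : ℕ) : ℤ) := by
        intro S
        have h1 := hm.slots_eq S
        unfold wt
        rw [h1]
        simp only [c, tch]
        split_ifs <;> push_cast <;> ring
      have hc2 : ∀ S, c S ≤ 2 := by intro S; simp only [c]; split_ifs <;> omega
      have hu2 := h.pd.sum_ind u c 2 (fun S _ _ => hc2 S)
      have hv2 := h.pd.sum_ind v c 2 (fun S _ _ => hc2 S)
      have h3 : ∑ S ∈ F, c S * (if u ∈ S then 1 else 0) +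
          ∑ S ∈ F, c S * (if v ∈ S then 1 else 0) ≤ 3 := by
        rcases not_and_or.mp hpp with hn | hn
        · push Not at hn
          have := h.pd.sum_ind u c 1 (fun S hS hu => by
            have : S.card ≠ 2 := fun hc => hn S hS hc hu
            simp [c, this])
          omega
        · push Not at hn
          have := h.pd.sum_ind v c 1 (fun S hS hv => by
            have : S.card ≠ 2 := fun hc => hn S hS hc hv
            simp [c, this])
          omega
      rw [Finset.sum_congr rfl fun S _ => hw S, Finset.sum_add_distrib, ← Nat.cast_sum,
        Finset.sum_add_distrib]
      omega

lemma opening {n A : ℕ} (r : ℕ) : ∀ (G : SimpleGraph (Fin n)) (F : Finset (Finset (Fin n)))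
    (X : Finset (Fin n)), OInv G F X → 4 * r ≤ X.card → (12 * A : ℤ) ≤ ∑ S ∈ F, wt G S + r →
    MWin (Has A 5) G := by
  induction r with
  | zero =>
    intro G F X h _ hW
    refine MWin.done _ ⟨F.filter (fun S => 5 ≤ slots G S), h.pd.subset (Finset.filter_subset _ _),
      ?_, ?_⟩
    · have h1 : ∑ S ∈ F, wt G S ≤ ∑ S ∈ F, if 5 ≤ slots G S then (12 : ℤ) else 0 := by
        refine Finset.sum_le_sum fun S hS => ?_
        have h2 := slots_le G S
        have h3 := h.card S hS
        unfold wt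
        split_ifs <;> omega
      rw [← Finset.sum_filter, Finset.sum_const, nsmul_eq_mul] at h1
      push_cast at hW
      have : (A : ℤ) ≤ ((F.filter (fun S => 5 ≤ slots G S)).card : ℤ) := by linarith
      exact_mod_cast this
    · intro S hS
      rw [Finset.mem_filter] at hS
      exact ⟨h.conn S hS.1, hS.2⟩
  | succ r ih =>
    intro G F X h hX hW
    obtain ⟨G', F', X', hm, hI, hX', hW'⟩ := opening_maker h (by omega)
    refine MWin.step _ _ hm fun G'' hG'' => ?_
    obtain ⟨F'', X'', hI', hX'', hW''⟩ := opening_breaker hI hG''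
    refine ih G'' F'' X'' hI' (by omega) ?_
    push_cast at hW ⊢
    linarith

lemma deg_bot {n : ℕ} (x : Fin n) : deg (⊥ : SimpleGraph (Fin n)) x = 0 := by
  unfold deg
  rw [Set.ncard_eq_zero (Set.toFinite _)]
  ext y; simp

lemma inv_bot {n : ℕ} : OInv (⊥ : SimpleGraph (Fin n)) ∅ Finset.univ := by
  constructor <;> simp [PD, deg_bot]

lemma start (l : ℕ) : ∃ N : ℕ, ∀ n ≥ N, ∀ G : SimpleGraph (Fin n),
    (GMove 4 n ⊥ G ∨ G = ⊥) → MWin (fun G => HasCliqueMinor G l) G := by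
  obtain ⟨A, hA⟩ := growth l (4 * (l * l))
  refine ⟨4 * (12 * A + 3) + 2, fun n hn G hG => ?_⟩
  obtain ⟨F, X, hI, hX, hW⟩ := opening_breaker (inv_bot (n := n)) hG
  have h1 : MWin (Has A 5) G := by
    refine opening (12 * A + 3) G F X hI ?_ ?_
    · simp at hX; omega
    · simp at hW; push_cast; omega
  refine (h1.trans (hA n)).trans fun G' hG' => has_final G' ?_
  obtain ⟨F, h1, h2, h3⟩ := hG'
  exact ⟨F, h1, h2, fun S hS => ⟨(h3 S hS).1, by have := (h3 S hS).2; omega⟩⟩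

lemma minor_mono {V : Type*} {G G' : SimpleGraph V} (hle : G ≤ G') {l : ℕ}
    (h : HasCliqueMinor G l) : HasCliqueMinor G' l := by
  obtain ⟨B, h1, h2, h3, h4⟩ := h
  refine ⟨B, h1, fun i => (h2 i).mono (SimpleGraph.comap_monotone _ hle), h3, fun i j hij => ?_⟩
  obtain ⟨u, hu, v, hv, ha⟩ := h4 i j hij
  exact ⟨u, hu, v, hv, hle ha⟩

lemma MWin.terminal {n : ℕ} {Q : SimpleGraph (Fin n) → Prop} {G : SimpleGraph (Fin n)}
    (h : MWin Q G) (ht : GTerminal 4 n G) : Q G := by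
  cases h with
  | done _ h => exact h
  | step _ G' hm _ => exact absurd hm (ht G')

lemma exists_strategy {n l : ℕ} : ∃ σ : SimpleGraph (Fin n) → SimpleGraph (Fin n),
    IsStrategy 4 n σ ∧ ∀ G, MWin (fun G => HasCliqueMinor G l) G → ¬ HasCliqueMinor G l →
      ∀ G'', (GMove 4 n (σ G) G'' ∨ G'' = σ G) → MWin (fun G => HasCliqueMinor G l) G'' := by
  classical
  let good : SimpleGraph (Fin n) → SimpleGraph (Fin n) → Prop := fun G G' =>
    GMove 4 n G G' ∧ ∀ G'', (GMove 4 n G' G'' ∨ G'' = G') → MWin (fun G => HasCliqueMinor G l) G''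
  have key : ∀ G, ∃ G', ((∃ G', GMove 4 n G G') → GMove 4 n G G') ∧
      ((∃ G', good G G') → good G G') := by
    intro G
    by_cases h : ∃ G', good G G'
    · obtain ⟨G', h'⟩ := h
      exact ⟨G', fun _ => h'.1, fun _ => h'⟩
    · by_cases h2 : ∃ G', GMove 4 n G G'
      · obtain ⟨G', h'⟩ := h2
        exact ⟨G', fun _ => h', fun hh => absurd hh h⟩
      · exact ⟨G, fun hh => absurd hh h2, fun hh => absurd hh h⟩
  choose σ h1 h2 using key
  refine ⟨σ, h1, fun G hG hn => ?_⟩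
  cases hG with
  | done _ h => exact absurd h hn
  | step _ G' hm hw => exact (h2 G ⟨G', hm, hw⟩).2

/-- For every `l` there is `N` such that for all `n ≥ N`, in the 4-regular graph game
on `n` vertices, regardless of who has the first move, a player has a strategy
ensuring that every terminal position contains a `K_l` minor. -/
theorem four_regular_game_clique_minor (l : ℕ) :
    ∃ N : ℕ, ∀ n ≥ N, ∀ first : Bool,
      ∃ σ : SimpleGraph (Fin n) → SimpleGraph (Fin n), IsStrategy 4 n σ ∧
        ∀ (f : ℕ → SimpleGraph (Fin n)) (T : ℕ), IsPlay 4 n σ first f T →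
          HasCliqueMinor (f T) l := by
  obtain ⟨N, hN⟩ := start l
  refine ⟨N, fun n hn first => ?_⟩
  obtain ⟨σ, hσ, hwin⟩ := exists_strategy (n := n) (l := l)
  refine ⟨σ, hσ, fun f T hplay => ?_⟩
  obtain ⟨h0, hmv, hfol, hterm⟩ := hplay
  -- invariant: on Maker's turn the position is winning; on Breaker's turn every reply is winning
  have key : ∀ i ≤ T, HasCliqueMinor (f i) l ∨
      ((((i % 2 = 0) ↔ first = true) → MWin (fun G => HasCliqueMinor G l) (f i)) ∧
       (¬ ((i % 2 = 0) ↔ first = true) → ∀ G'', (GMove 4 n (f i) G'' ∨ G'' = f i) →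
          MWin (fun G => HasCliqueMinor G l) G'')) := by
    intro i
    induction i with
    | zero =>
      intro _
      right
      rw [h0]
      exact ⟨fun _ => hN n hn _ (Or.inr rfl), fun _ G'' h => hN n hn _ h⟩
    | succ i ih =>
      intro hi
      have hm := hmv i (by omega)
      have hle : f i ≤ f (i + 1) := by
        obtain ⟨u, v, h⟩ := hm
        exact EMove.le (u := u) (v := v) h
      by_cases hQ : HasCliqueMinor (f i) l
      · left; exact minor_mono hle hQ
      · rcases ih (by omega) with h | ⟨hA, hB⟩
        · exact absurd h hQ
        · right
          have hpar : ((i + 1) % 2 = 0) ↔ ¬ (i % 2 = 0) := by omega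
          by_cases ht : (i % 2 = 0) ↔ first = true
          · refine ⟨fun h => absurd h (by rw [hpar]; tauto), fun _ => ?_⟩
            rw [hfol i (by omega) ht]
            exact hwin _ (hA ht) hQ
          · refine ⟨fun _ => hB ht _ (Or.inl hm), fun h => absurd ?_ h⟩
            rw [hpar]; tauto
  rcases key T le_rfl with h | ⟨hA, hB⟩
  · exact h
  · by_cases ht : (T % 2 = 0) ↔ first = true
    · exact (hA ht).terminal hterm
    · exact (hB ht _ (Or.inr rfl)).terminal hterm
end

section
/- For all natural numbers b, Δ, s and k there exists N such that: for every finite connected simple graph G with maximum degree at most Δ, and every vertex labelling ℓ : V(G) → ℕ with ℓ(v) ≤ b for all vertices v and with total label sum Σ_{v ∈ V(G)} ℓ(v) ≥ N, there exist k pairwise vertex-disjoint nonempty connected subgraphs of G, each of whose vertex sets has label sum at least s. -/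
-- The label sum `ℓ(S)` of a set `S` of vertices.
open Classical in
noncomputable def labelSum {V : Type*} [Fintype V] (ℓ : V → ℕ) (S : Set V) : ℕ :=
  ∑ v : V, if v ∈ S then ℓ v else 0

/-- Reachability inside a finset. -/
def Rch {V : Type} (G : SimpleGraph V) (S : Finset V) : V → V → Prop :=
  Relation.ReflTransGen (fun x y => G.Adj x y ∧ x ∈ S ∧ y ∈ S)

/-- Connectedness (or emptiness) of a finset. -/
def Cn {V : Type} (G : SimpleGraph V) (S : Finset V) : Prop :=
  ∀ x ∈ S, ∀ y ∈ S, Rch G S x y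

theorem Rch.symm {V : Type} {G : SimpleGraph V} {S : Finset V} {x y : V}
    (h : Rch G S x y) : Rch G S y x := by
  induction h with
  | refl => exact .refl
  | tail _ h ih => exact .head ⟨h.1.symm, h.2.2, h.2.1⟩ ih

theorem Rch.mono {V : Type} {G : SimpleGraph V} {S T : Finset V} (hST : S ⊆ T) {x y : V}
    (h : Rch G S x y) : Rch G T x y := by
  induction h with
  | refl => exact .refl
  | tail _ h ih => exact ih.tail ⟨h.1, hST h.2.1, hST h.2.2⟩

theorem Cn.of_center {V : Type} {G : SimpleGraph V} {S : Finset V} (a : V)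
    (h : ∀ x ∈ S, Rch G S a x) : Cn G S :=
  fun x hx y hy => (h x hx).symm.trans (h y hy)

theorem Cn.connected {V : Type} {G : SimpleGraph V} {S : Finset V} (h : Cn G S)
    (hne : S.Nonempty) : (G.induce (S : Set V)).Connected := by
  have key : ∀ x y, Rch G S x y → ∀ (hx : x ∈ S) (hy : y ∈ S),
      (G.induce (S : Set V)).Reachable ⟨x, hx⟩ ⟨y, hy⟩ := by
    intro x y h
    induction h with
    | refl => intro _ _; exact .refl _
    | tail _ h ih =>
      intro hx hy
      refine (ih hx h.2.1).trans (SimpleGraph.Adj.reachable ?_)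
      exact h.1
  obtain ⟨z, hz⟩ := hne
  have : Nonempty (S : Set V) := ⟨⟨z, hz⟩⟩
  exact ⟨fun x y => key _ _ (h x x.2 y y.2) x.2 y.2⟩

theorem Cn.univ {V : Type} [Fintype V] {G : SimpleGraph V} (h : G.Connected) :
    Cn G Finset.univ := by
  intro x _ y _
  obtain ⟨p⟩ := h.preconnected x y
  induction p with
  | nil => exact .refl
  | cons h _ ih => exact .head ⟨h, by simp, by simp⟩ (ih (by simp) (by simp))

open Classical in
theorem peel {V : Type} [Fintype V] (G : SimpleGraph V) (b Δ s : ℕ) (hs : 0 < s)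
    (hd : ∀ v, deg G v ≤ Δ) (ℓ : V → ℕ) (hb : ∀ v, ℓ v ≤ b) (C : Finset V) (hC : Cn G C)
    (hsum : s ≤ ∑ v ∈ C, ℓ v) :
    ∃ A ⊆ C, Cn G A ∧ Cn G (C \ A) ∧ s ≤ ∑ v ∈ A, ℓ v ∧ ∑ v ∈ A, ℓ v ≤ b + Δ * s := by
  let P : Finset V → Prop := fun A => A ⊆ C ∧ Cn G A ∧ Cn G (C \ A) ∧ s ≤ ∑ v ∈ A, ℓ v
  have hPC : P C := ⟨subset_rfl, hC, by intro x hx; simp at hx, hsum⟩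
  obtain ⟨A, hA, hmin⟩ := Finset.exists_min_image (Finset.univ.filter P) Finset.card
    ⟨C, by simpa using hPC⟩
  simp only [Finset.mem_filter, Finset.mem_univ, true_and] at hA hmin
  obtain ⟨hAC, hAc, hDc, hAs⟩ := hA
  refine ⟨A, hAC, hAc, hDc, hAs, ?_⟩
  have hAne : A.Nonempty := by
    rw [Finset.nonempty_iff_ne_empty]; rintro rfl; simp at hAs; omega
  -- attachment vertex
  obtain ⟨a, haA, had⟩ : ∃ a ∈ A, ∀ x ∈ C \ A, ∃ d ∈ C \ A, G.Adj a d := by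
    by_cases hD : (C \ A).Nonempty
    · obtain ⟨d, hd⟩ := hD
      obtain ⟨a, ha⟩ := hAne
      have hr := hC a (hAC ha) d (Finset.mem_sdiff.1 hd).1
      have : d ∈ A ∨ ∃ a ∈ A, ∃ d ∈ C \ A, G.Adj a d := by
        clear hd
        induction hr with
        | refl => exact .inl ha
        | @tail y z _ h ih =>
          rcases ih with ih | ih
          · by_cases hz : z ∈ A
            · exact .inl hz
            · exact .inr ⟨y, ih, z, Finset.mem_sdiff.2 ⟨h.2.2, hz⟩, h.1⟩
          · exact .inr ih
      rcases this with h | ⟨a, ha, d, hd, h⟩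
      · exact absurd h (Finset.mem_sdiff.1 hd).2
      · exact ⟨a, ha, fun _ _ => ⟨d, hd, h⟩⟩
    · obtain ⟨a, ha⟩ := hAne
      exact ⟨a, ha, fun x hx => absurd ⟨x, hx⟩ hD⟩
  let K : V → Finset V := fun n => (A.erase a).filter (fun y => Rch G (A.erase a) n y)
  let T : Finset V := Finset.univ.filter (fun n => G.Adj a n ∧ n ∈ A.erase a)
  have hcov : ∀ x ∈ A.erase a, ∃ n ∈ T, x ∈ K n := by
    intro x hx
    have hr := hAc a haA x (Finset.mem_of_mem_erase hx)
    have : x = a ∨ ∃ n ∈ T, x ∈ K n := by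
      clear hx
      induction hr with
      | refl => exact .inl rfl
      | @tail y z _ h ih =>
        by_cases hz : z = a
        · exact .inl hz
        have hzA : z ∈ A.erase a := Finset.mem_erase.2 ⟨hz, h.2.2⟩
        right
        rcases ih with rfl | ⟨n, hn, hy⟩
        · exact ⟨z, Finset.mem_filter.2 ⟨Finset.mem_univ _, h.1, hzA⟩,
            Finset.mem_filter.2 ⟨hzA, .refl⟩⟩
        · have hy' := Finset.mem_filter.1 hy
          exact ⟨n, hn, Finset.mem_filter.2 ⟨hzA, hy'.2.tail ⟨h.1, hy'.1, hzA⟩⟩⟩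
    exact this.resolve_left (Finset.mem_erase.1 hx).1
  have hKr : ∀ n ∈ T, ∀ y ∈ K n, Rch G (K n) n y := by
    intro n hn y hy
    have hn' := (Finset.mem_filter.1 hn).2.2
    have hr := (Finset.mem_filter.1 hy).2
    clear hy
    induction hr with
    | refl => exact .refl
    | @tail y z hy h ih =>
      exact ih.tail ⟨h.1, Finset.mem_filter.2 ⟨h.2.1, hy⟩,
        Finset.mem_filter.2 ⟨h.2.2, hy.tail h⟩⟩
  have hKself : ∀ n ∈ T, n ∈ K n := fun n hn =>
    Finset.mem_filter.2 ⟨(Finset.mem_filter.1 hn).2.2, .refl⟩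
  have hKA : ∀ n, K n ⊆ A.erase a := fun n => Finset.filter_subset _ _
  have hcomp : ∀ n ∈ T, Cn G (C \ K n) := by
    intro n hn
    have haK : a ∈ C \ K n := Finset.mem_sdiff.2
      ⟨hAC haA, fun h => (Finset.mem_erase.1 (hKA n h)).1 rfl⟩
    apply Cn.of_center a
    intro x hx
    obtain ⟨hxC, hxK⟩ := Finset.mem_sdiff.1 hx
    by_cases hxA : x ∈ A
    · by_cases hxa : x = a
      · subst hxa; exact .refl
      obtain ⟨m, hm, hxm⟩ := hcov x (Finset.mem_erase.2 ⟨hxa, hxA⟩)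
      have hsub : K m ⊆ C \ K n := by
        intro y hy
        refine Finset.mem_sdiff.2 ⟨hAC (Finset.mem_of_mem_erase (hKA m hy)), fun hyn => hxK ?_⟩
        have h1 := (Finset.mem_filter.1 hyn).2
        have h2 := (Finset.mem_filter.1 hy).2
        have h3 := Finset.mem_filter.1 hxm
        exact Finset.mem_filter.2 ⟨h3.1, (h1.trans (Rch.symm h2)).trans h3.2⟩
      exact .head ⟨(Finset.mem_filter.1 hm).2.1, haK, hsub (hKself m hm)⟩
        ((hKr m hm x hxm).mono hsub)
    · have hxD : x ∈ C \ A := Finset.mem_sdiff.2 ⟨hxC, hxA⟩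
      obtain ⟨d, hd, hadj⟩ := had x hxD
      have hsub : C \ A ⊆ C \ K n :=
        Finset.sdiff_subset_sdiff subset_rfl ((hKA n).trans (Finset.erase_subset _ _))
      exact .head ⟨hadj, haK, hsub hd⟩ ((hDc d hd x hxD).mono hsub)
  have hKs : ∀ n ∈ T, ∑ v ∈ K n, ℓ v ≤ s := by
    intro n hn
    by_contra hlt
    have hle := hmin (K n) ⟨((hKA n).trans (Finset.erase_subset _ _)).trans hAC,
      Cn.of_center n (hKr n hn), hcomp n hn, by omega⟩
    have h1 := Finset.card_le_card (hKA n)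
    have h2 := Finset.card_erase_lt_of_mem haA
    omega
  have hT : T.card ≤ Δ := by
    refine le_trans ?_ (hd a)
    unfold deg
    rw [← Set.ncard_coe_finset]
    apply Set.ncard_le_ncard _ (Set.toFinite _)
    intro n hn
    exact (Finset.mem_filter.1 (Finset.mem_coe.1 hn)).2.1
  rw [← Finset.add_sum_erase A ℓ haA]
  apply Nat.add_le_add (hb a)
  calc ∑ v ∈ A.erase a, ℓ v ≤ ∑ v ∈ T.biUnion K, ℓ v :=
        Finset.sum_le_sum_of_subset (fun x hx => Finset.mem_biUnion.2 (hcov x hx))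
    _ ≤ ∑ n ∈ T, ∑ v ∈ K n, ℓ v := by
        generalize T = T'
        induction T' using Finset.induction_on with
        | empty => simp
        | insert n T' hn ih =>
          rw [Finset.biUnion_insert, Finset.sum_insert hn]
          have := Finset.sum_union_inter (s₁ := K n) (s₂ := T'.biUnion K) (f := ℓ)
          omega
    _ ≤ T.card * s := by
        simpa using Finset.sum_le_card_nsmul T _ s hKs
    _ ≤ Δ * s := Nat.mul_le_mul_right _ hT

open Classical in
theorem peel_many {V : Type} [Fintype V] (G : SimpleGraph V) (b Δ s : ℕ) (hs : 0 < s)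
    (hd : ∀ v, deg G v ≤ Δ) (ℓ : V → ℕ) (hb : ∀ v, ℓ v ≤ b) (k : ℕ) :
    ∀ C : Finset V, Cn G C → k * (b + Δ * s + s) ≤ ∑ v ∈ C, ℓ v →
    ∃ B : Fin k → Finset V, (∀ i, B i ⊆ C) ∧ (∀ i, Cn G (B i)) ∧
      (∀ i j, i ≠ j → Disjoint (B i) (B j)) ∧ ∀ i, s ≤ ∑ v ∈ B i, ℓ v := by
  induction k with
  | zero => intro C _ _; exact ⟨fun i => i.elim0, fun i => i.elim0, fun i => i.elim0,
      fun i => i.elim0, fun i => i.elim0⟩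
  | succ k ih =>
    intro C hC hsum
    rw [Nat.succ_mul] at hsum
    obtain ⟨A, hAC, hA, hD, hAs, hAu⟩ := peel G b Δ s hs hd ℓ hb C hC (by omega)
    have hsd := Finset.sum_sdiff (f := ℓ) hAC
    obtain ⟨B, hB1, hB2, hB3, hB4⟩ := ih (C \ A) hD (by omega)
    have hdis : ∀ i, Disjoint A (B i) := fun i =>
      Finset.disjoint_of_subset_right (hB1 i) Finset.disjoint_sdiff
    refine ⟨Fin.cons A B, ?_, ?_, ?_, ?_⟩
    · intro i
      cases i using Fin.cases with
      | zero => exact hAC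
      | succ i => exact (hB1 i).trans Finset.sdiff_subset
    · intro i
      cases i using Fin.cases with
      | zero => exact hA
      | succ i => exact hB2 i
    · intro i j hij
      cases i using Fin.cases with
      | zero =>
        cases j using Fin.cases with
        | zero => exact absurd rfl hij
        | succ j => exact hdis j
      | succ i =>
        cases j using Fin.cases with
        | zero => exact (hdis i).symm
        | succ j => exact hB3 i j (fun h => hij (by rw [h]))
    · intro i
      cases i using Fin.cases with
      | zero => exact hAs
      | succ i => exact hB4 i

/-- For all `b, Δ, s, k` there is `N` such that every finite connected simple graph
with maximum degree at most `Δ`, whose vertex labels are bounded by `b` and have total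
sum at least `N`, contains `k` pairwise disjoint nonempty connected subgraphs each
of label sum at least `s`. -/
theorem exists_many_disjoint_connected_large_label_subgraphs (b Δ s k : ℕ) :
    ∃ N : ℕ, ∀ (V : Type) [Fintype V] (G : SimpleGraph V), G.Connected →
      (∀ v, deg G v ≤ Δ) → ∀ ℓ : V → ℕ, (∀ v, ℓ v ≤ b) → N ≤ ∑ v, ℓ v →
      ∃ B : Fin k → Set V,
        (∀ i, (B i).Nonempty) ∧
        (∀ i, (G.induce (B i)).Connected) ∧
        (∀ i j, i ≠ j → Disjoint (B i) (B j)) ∧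
        (∀ i, s ≤ labelSum ℓ (B i)) := by
  refine ⟨k * (b + Δ * (s + 1) + (s + 1)), ?_⟩
  intro V _ G hG hd ℓ hb hN
  obtain ⟨B, -, hB2, hB3, hB4⟩ :=
    peel_many G b Δ (s + 1) (Nat.succ_pos s) hd ℓ hb k Finset.univ (Cn.univ hG) hN
  have hne : ∀ i, (B i).Nonempty := by
    intro i
    rw [Finset.nonempty_iff_ne_empty]
    intro h
    have := hB4 i
    rw [h] at this
    simp at this
  refine ⟨fun i => (B i : Set V), fun i => by simpa using hne i,
    fun i => (hB2 i).connected (hne i), fun i j hij => by simpa using hB3 i j hij, ?_⟩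
  intro i
  have h := hB4 i
  have : labelSum ℓ (B i : Set V) = ∑ v ∈ B i, ℓ v := by
    classical
    unfold labelSum
    simp [Finset.sum_ite_mem]
  rw [this]
  omega
end

section
/- For all natural numbers b and Δ with Δ ≥ 2 there exists N such that: for every finite tree T with at least two vertices and maximum degree at most Δ, and every vertex labelling ℓ : V(T) → ℕ with ℓ(v) ≤ b for all v and total label sum at least N, there exists an edge e of T such that the two connected components C_1 and C_2 of T − e satisfy ℓ(C_1) < Δ · ℓ(C_2) and ℓ(C_2) < Δ · ℓ(C_1). -/
/-- The set of vertices reachable from `u` in `G` (the connected component of `u`). -/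
def reachSet {V : Type*} (G : SimpleGraph V) (u : V) : Set V :=
  {w | G.Reachable u w}

theorem side_disj {V : Type*} (T : SimpleGraph V) (hT : T.IsTree) {u v : V}
    (h : T.Adj u v) : ¬ (T.deleteEdges {s(u, v)}).Reachable u v := by
  have h1 := (SimpleGraph.isAcyclic_iff_forall_adj_isBridge.mp hT.isAcyclic) h
  rw [SimpleGraph.isBridge_iff] at h1
  exact h1

theorem side_sub {V : Type*} (T : SimpleGraph V) (hT : T.IsTree) {u v w : V}
    (hw : T.Adj v w) (hne : w ≠ u) :
    reachSet (T.deleteEdges {s(v, w)}) w ⊆ reachSet (T.deleteEdges {s(u, v)}) v := by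
  have key := side_disj T hT hw
  have hwv := hw.ne
  intro x hx
  have hx' : (T.deleteEdges {s(v, w)}).Reachable w x := hx
  change (T.deleteEdges {s(u, v)}).Reachable v x
  rw [SimpleGraph.reachable_iff_reflTransGen] at hx'
  induction hx' with
  | refl =>
    apply SimpleGraph.Adj.reachable
    rw [SimpleGraph.deleteEdges_adj]
    refine ⟨hw, ?_⟩
    simp only [Set.mem_singleton_iff, Sym2.eq_iff]
    grind
  | @tail y z hy hyz ih =>
    rw [← SimpleGraph.reachable_iff_reflTransGen] at hy
    refine (ih hy).trans ?_
    have hz := hy.trans hyz.reachable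
    have hyv : y ≠ v := by rintro rfl; exact key hy.symm
    have hzv : z ≠ v := by rintro rfl; exact key hz.symm
    apply SimpleGraph.Adj.reachable
    rw [SimpleGraph.deleteEdges_adj] at hyz ⊢
    refine ⟨hyz.1, ?_⟩
    simp only [Set.mem_singleton_iff, Sym2.eq_iff]
    grind

theorem side_cover {V : Type*} (T : SimpleGraph V) (hT : T.IsTree) (v x : V) (hx : x ≠ v) :
    ∃ w, T.Adj v w ∧ x ∈ reachSet (T.deleteEdges {s(v, w)}) w := by
  classical
  obtain ⟨p, hp⟩ := (hT.connected.preconnected v x).exists_isPath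
  cases p with
  | nil => exact absurd rfl hx
  | @cons _ w _ h q =>
    rw [SimpleGraph.Walk.cons_isPath_iff] at hp
    refine ⟨w, h, ⟨q.toDeleteEdge s(v, w) ?_⟩⟩
    intro he
    exact hp.2 (q.fst_mem_support_of_mem_edges he)

theorem labelSum_disj {V : Type*} [Fintype V] (ℓ : V → ℕ) (A B : Set V)
    (h : ∀ x, x ∈ A → x ∈ B → False) : labelSum ℓ A + labelSum ℓ B ≤ ∑ v, ℓ v := by
  classical
  unfold labelSum
  rw [← Finset.sum_add_distrib]
  apply Finset.sum_le_sum
  intro x _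
  have := h x
  split_ifs <;> simp_all

theorem sum_cover {V : Type*} [Fintype V] (ℓ : V → ℕ) (v : V) (s : Finset V)
    (A : V → Set V) (h : ∀ x, x ≠ v → ∃ w ∈ s, x ∈ A w) :
    ∑ x, ℓ x ≤ ℓ v + ∑ w ∈ s, labelSum ℓ (A w) := by
  classical
  unfold labelSum
  rw [Finset.sum_comm, ← Finset.add_sum_erase _ _ (Finset.mem_univ v)]
  apply Nat.add_le_add_left
  refine le_trans ?_ (Finset.sum_le_sum_of_subset (Finset.erase_subset v _))
  apply Finset.sum_le_sum
  intro x hx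
  obtain ⟨w, hw, hxw⟩ := h x (Finset.ne_of_mem_erase hx)
  refine le_trans ?_ (Finset.single_le_sum (fun _ _ => Nat.zero_le _) hw)
  simp [hxw]

/-- For all `b` and `Δ ≥ 2` there is `N` such that every finite tree with at least two
vertices and maximum degree at most `Δ`, with vertex labels bounded by `b` and of total
sum at least `N`, has an edge `e = uv` whose two components `C₁ ∋ u`, `C₂ ∋ v` in `T - e`
satisfy `ℓ(C₁) < Δ·ℓ(C₂)` and `ℓ(C₂) < Δ·ℓ(C₁)`. -/
theorem exists_balanced_edge_in_tree (b Δ : ℕ) (hΔ : 2 ≤ Δ) :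
    ∃ N : ℕ, ∀ (V : Type) [Fintype V] (T : SimpleGraph V), T.IsTree →
      (∀ v, deg T v ≤ Δ) → 2 ≤ Fintype.card V →
      ∀ ℓ : V → ℕ, (∀ v, ℓ v ≤ b) → N ≤ ∑ v, ℓ v →
      ∃ u v : V, T.Adj u v ∧
        labelSum ℓ (reachSet (T.deleteEdges {s(u, v)}) u) <
          Δ * labelSum ℓ (reachSet (T.deleteEdges {s(u, v)}) v) ∧
        labelSum ℓ (reachSet (T.deleteEdges {s(u, v)}) v) <
          Δ * labelSum ℓ (reachSet (T.deleteEdges {s(u, v)}) u) := by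
  refine ⟨b * (Δ + 1) + 1, ?_⟩
  intro V _ T hT hdeg hcard ℓ hb hN
  classical
  by_contra hcon
  push Not at hcon
  set S := ∑ v, ℓ v with hS
  let side : V → V → Set V := fun u v => reachSet (T.deleteEdges {s(u, v)}) v
  have hside : ∀ u v, reachSet (T.deleteEdges {s(u, v)}) u = side v u := by
    intro u v
    simp only [side, Sym2.eq_swap]
  have hlight : ∀ u v, T.Adj u v → (Δ + 1) * labelSum ℓ (side u v) ≤ S ∨
      (Δ + 1) * labelSum ℓ (side v u) ≤ S := by
    intro u v huv
    have hd : labelSum ℓ (side u v) + labelSum ℓ (side v u) ≤ S := by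
      apply labelSum_disj
      intro x hx hx'
      rw [← hside] at hx'
      have h1 : (T.deleteEdges {s(u, v)}).Reachable v x := hx
      have h2 : (T.deleteEdges {s(u, v)}).Reachable u x := hx'
      exact side_disj T hT huv (h2.trans h1.symm)
    have h3 := hcon u v huv
    rw [hside u v] at h3
    change labelSum ℓ (side v u) < Δ * labelSum ℓ (side u v) →
      Δ * labelSum ℓ (side v u) ≤ labelSum ℓ (side u v) at h3
    rw [add_mul, add_mul, one_mul, one_mul]
    by_cases h4 : labelSum ℓ (side v u) < Δ * labelSum ℓ (side u v)
    · right; have := h3 h4; omega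
    · left; omega
  let P : Finset (V × V) := Finset.univ.filter
    (fun p => T.Adj p.1 p.2 ∧ (Δ + 1) * labelSum ℓ (side p.2 p.1) ≤ S)
  have hP : P.Nonempty := by
    have : Nontrivial V := Fintype.one_lt_card_iff_nontrivial.mp hcard
    obtain ⟨a⟩ := hT.connected.nonempty
    obtain ⟨c, hc⟩ := exists_ne a
    obtain ⟨w, hw, -⟩ := side_cover T hT a c hc
    rcases hlight a w hw with h | h
    · exact ⟨(w, a), by simp [P, hw.symm, h]⟩
    · exact ⟨(a, w), by simp [P, hw, h]⟩
  obtain ⟨⟨u, v⟩, huv, hmin⟩ := Finset.exists_min_image P (fun p => (side p.1 p.2).ncard) hP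
  simp only [P, Finset.mem_filter, Finset.mem_univ, true_and] at huv hmin
  have hall : ∀ w, T.Adj v w → (Δ + 1) * labelSum ℓ (side v w) ≤ S := by
    intro w hw
    by_cases hwu : w = u
    · subst hwu; exact huv.2
    rcases hlight v w hw with h | h
    · exact h
    exfalso
    have h1 := hmin (v, w) ⟨hw, h⟩
    have h2 : side v w ⊂ side u v := by
      refine ⟨side_sub T hT hw hwu, fun hsub => ?_⟩
      have h3 : v ∈ side v w := hsub (SimpleGraph.Reachable.refl v)
      have h4 : (T.deleteEdges {s(v, w)}).Reachable w v := h3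
      exact side_disj T hT hw h4.symm
    have h5 := Set.ncard_lt_ncard h2 (Set.toFinite _)
    simp only at h1
    omega
  have hc := sum_cover ℓ v (T.neighborFinset v) (side v) (by
    intro x hx
    obtain ⟨w, hw, hxw⟩ := side_cover T hT v x hx
    exact ⟨w, by simpa using hw, hxw⟩)
  have hd : (T.neighborFinset v).card ≤ Δ := by
    have := hdeg v
    rwa [deg, ← SimpleGraph.coe_neighborFinset, Set.ncard_coe_finset] at this
  have h6 : (Δ + 1) * ∑ w ∈ T.neighborFinset v, labelSum ℓ (side v w) ≤ Δ * S := by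
    rw [Finset.mul_sum]
    refine (Finset.sum_le_card_nsmul _ _ S (fun w hw => hall w (by simpa using hw))).trans ?_
    rw [smul_eq_mul]
    exact Nat.mul_le_mul_right _ hd
  rw [← hS] at hc
  have h7 := hb v
  nlinarith
end

section
/- Let Δ ≥ 2 and b be natural numbers, let T be a finite tree with maximum degree at most Δ, and let ℓ : V(T) → ℕ be a vertex labelling with ℓ(v) ≤ b for all v. Let e be an edge of T with components C_1, C_2 of T − e satisfying Δ · ℓ(C_2) < ℓ(C_1) and b · Δ · (Δ − 1) < ℓ(C_1). Let x be the endpoint of e lying in C_1. Then x has a neighbor y in C_1, and for y chosen so that the component D of T − {x,y} containing y has maximum label sum among the components of C_1 − x, the edge e' = xy satisfies: the two components D (containing y) and T∖D (containing x) of T − e' obey ℓ(T∖D) · ℓ(C_1) ≤ ((Δ − 1) · ℓ(C_1) + Δ · ℓ(C_2)) · ℓ(D); in particular ℓ(T∖D) < Δ · ℓ(D). -/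
theorem labelSum_compl_add {V : Type*} [Fintype V] (ℓ : V → ℕ) (S : Set V) :
    labelSum ℓ S + labelSum ℓ Sᶜ = ∑ v, ℓ v := by
  classical
  unfold labelSum
  rw [← Finset.sum_add_distrib]
  apply Finset.sum_congr rfl
  intro v _
  by_cases h : v ∈ S <;> simp [h]

theorem total_le {V : Type*} [Fintype V] (ℓ : V → ℕ) (S R : Set V) (h : ∀ v, v ∈ S ∨ v ∈ R) :
    ∑ v, ℓ v ≤ labelSum ℓ S + labelSum ℓ R := by
  classical
  unfold labelSum
  rw [← Finset.sum_add_distrib]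
  apply Finset.sum_le_sum
  intro v _
  rcases h v with h | h <;> simp [h]

theorem labelSum_cover {V : Type*} [Fintype V] (ℓ : V → ℕ) (S : Set V) (x : V)
    (N : Finset V) (D : V → Set V) (h : ∀ v ∈ S, v = x ∨ ∃ y ∈ N, v ∈ D y) :
    labelSum ℓ S ≤ ℓ x + ∑ y ∈ N, labelSum ℓ (D y) := by
  classical
  unfold labelSum
  rw [Finset.sum_comm]
  have hx : ℓ x = ∑ v, if v = x then ℓ v else 0 := by simp
  rw [hx, ← Finset.sum_add_distrib]
  apply Finset.sum_le_sum
  intro v _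
  by_cases hv : v ∈ S
  · rw [if_pos hv]
    rcases h v hv with h | ⟨y, hy, hvy⟩
    · simp [h]
    · have := Finset.single_le_sum (f := fun y => if v ∈ D y then ℓ v else 0)
        (fun _ _ => Nat.zero_le _) hy
      simp only [if_pos hvy] at this
      omega
  · simp [hv]

theorem reach_split {V : Type*} (T : SimpleGraph V) (x z w : V)
    (h : T.Reachable x w) :
    (T.deleteEdges {s(x, z)}).Reachable x w ∨ (T.deleteEdges {s(x, z)}).Reachable z w := by
  have h' : T.Reachable w x := h.symm
  clear h
  obtain ⟨p⟩ := h'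
  generalize hu : x = u at p
  induction p with
  | nil => subst hu; exact Or.inl (SimpleGraph.Reachable.refl _)
  | @cons a c d hac p ih =>
    subst hu
    by_cases hax : a = x
    · left; rw [hax]
    by_cases haz : a = z
    · right; rw [haz]
    have hadj : (T.deleteEdges {s(x, z)}).Adj c a := by
      rw [SimpleGraph.deleteEdges_adj]
      refine ⟨hac.symm, ?_⟩
      simp [haz, hax]
    rcases ih rfl with h | h
    · exact Or.inl (h.trans hadj.reachable)
    · exact Or.inr (h.trans hadj.reachable)

theorem reach_first {V : Type*} (T : SimpleGraph V) (x z w : V)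
    (h : (T.deleteEdges {s(x, z)}).Reachable x w) (hw : w ≠ x) :
    ∃ y, T.Adj x y ∧ y ≠ z ∧ (T.deleteEdges {s(x, y)}).Reachable y w := by
  classical
  obtain ⟨p, hp⟩ := h.exists_isPath
  cases p with
  | nil => exact absurd rfl hw
  | @cons _ y _ hxy p =>
    rw [SimpleGraph.Walk.cons_isPath_iff] at hp
    rw [SimpleGraph.deleteEdges_adj] at hxy
    refine ⟨y, hxy.1, ?_, ?_⟩
    · rintro rfl; simp at hxy
    · refine ⟨(p.mapLe (SimpleGraph.deleteEdges_le _)).toDeleteEdges _ ?_⟩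
      intro e he hes
      simp only [Set.mem_singleton_iff] at hes
      subst hes
      have := SimpleGraph.Walk.fst_mem_support_of_mem_edges _ he
      simp at this
      exact hp.2 this

theorem arith1 (b Δ L d : ℕ) (hΔ : 2 ≤ Δ) (h : L ≤ b + (Δ - 1) * d)
    (hbig : b * Δ * (Δ - 1) < L) : L ≤ Δ * d := by
  obtain ⟨k, rfl⟩ : ∃ k, Δ = k + 2 := ⟨Δ - 2, by omega⟩
  simp only [show k + 2 - 1 = k + 1 by omega] at *
  by_contra hc
  push Not at hc
  have h1 : (k + 1) * ((k + 2) * d) ≤ (k + 1) * L := Nat.mul_le_mul_left _ hc.le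
  have h2 : (k + 2) * L ≤ (k + 2) * (b + (k + 1) * d) := Nat.mul_le_mul_left _ h
  nlinarith [Nat.zero_le (b * k * (k+2))]

theorem arith2 (Δ L1 L2 d e : ℕ) (hΔ : 2 ≤ Δ) (h : L1 ≤ Δ * d)
    (hr : Δ * L2 < L1) (ht : d + e ≤ L1 + L2) :
    e * L1 ≤ ((Δ - 1) * L1 + Δ * L2) * d ∧ e < Δ * d := by
  obtain ⟨k, rfl⟩ : ∃ k, Δ = k + 1 := ⟨Δ - 1, by omega⟩
  simp only [Nat.add_sub_cancel] at *
  have h1 : e * L1 ≤ (k * L1 + (k + 1) * L2) * d := by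
    have h2 := Nat.mul_le_mul_right L1 ht
    have h3 := Nat.mul_le_mul_left (L1 + L2) h
    nlinarith
  refine ⟨h1, ?_⟩
  have hd : 0 < d := by
    rcases Nat.eq_zero_or_pos d with h0 | h0
    · subst h0; omega
    · exact h0
  have h4 := Nat.mul_lt_mul_of_pos_right hr hd
  have : e * L1 < ((k + 1) * d) * L1 := by nlinarith
  exact lt_of_mul_lt_mul_right this (Nat.zero_le _)

/-- Let `T` be a finite tree of maximum degree at most `Δ` (`Δ ≥ 2`) with labels
bounded by `b`, and let `e = xz` be an edge whose components `C₁ ∋ x`, `C₂ ∋ z` of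
`T - e` satisfy `Δ·ℓ(C₂) < ℓ(C₁)` and `b·Δ·(Δ-1) < ℓ(C₁)`.  Then `x` has a neighbor
`y` in `C₁`; and if `y` is such a neighbor for which the component `D` of `T - xy`
containing `y` has maximum label sum among the components of `C₁ - x`, then
`ℓ(T∖D)·ℓ(C₁) ≤ ((Δ-1)·ℓ(C₁) + Δ·ℓ(C₂))·ℓ(D)`, and in particular
`ℓ(T∖D) < Δ·ℓ(D)`. -/
theorem tree_walk_towards_balanced_edge (b Δ : ℕ) (hΔ : 2 ≤ Δ)
    (V : Type) [Fintype V] (T : SimpleGraph V) (hT : T.IsTree)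
    (hdeg : ∀ v, deg T v ≤ Δ) (ℓ : V → ℕ) (hb : ∀ v, ℓ v ≤ b)
    (x z : V) (hxz : T.Adj x z)
    (C₁ C₂ : Set V)
    (hC₁ : C₁ = reachSet (T.deleteEdges {s(x, z)}) x)
    (hC₂ : C₂ = reachSet (T.deleteEdges {s(x, z)}) z)
    (hratio : Δ * labelSum ℓ C₂ < labelSum ℓ C₁)
    (hbig : b * Δ * (Δ - 1) < labelSum ℓ C₁) :
    (∃ y, T.Adj x y ∧ y ∈ C₁) ∧
    ∀ y, T.Adj x y → y ∈ C₁ →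
      (∀ y', T.Adj x y' → y' ∈ C₁ →
        labelSum ℓ (reachSet (T.deleteEdges {s(x, y')}) y') ≤
          labelSum ℓ (reachSet (T.deleteEdges {s(x, y)}) y)) →
      labelSum ℓ (reachSet (T.deleteEdges {s(x, y)}) y)ᶜ * labelSum ℓ C₁ ≤
          ((Δ - 1) * labelSum ℓ C₁ + Δ * labelSum ℓ C₂) *
            labelSum ℓ (reachSet (T.deleteEdges {s(x, y)}) y) ∧
        labelSum ℓ (reachSet (T.deleteEdges {s(x, y)}) y)ᶜ <
          Δ * labelSum ℓ (reachSet (T.deleteEdges {s(x, y)}) y) := by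
  classical
  subst hC₁ hC₂
  set C₁ := reachSet (T.deleteEdges {s(x, z)}) x with hC₁
  set C₂ := reachSet (T.deleteEdges {s(x, z)}) z with hC₂
  set N : Finset V := (T.neighborSet x).toFinset.erase z with hN
  have hNC : ∀ y ∈ N, T.Adj x y ∧ y ∈ C₁ := by
    intro y hy
    simp only [hN, Finset.mem_erase, Set.mem_toFinset, SimpleGraph.mem_neighborSet] at hy
    refine ⟨hy.2, ?_⟩
    apply SimpleGraph.Adj.reachable
    rw [SimpleGraph.deleteEdges_adj]
    refine ⟨hy.2, ?_⟩
    have := hy.2.ne'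
    simp [hy.1, this]
  have hcard : N.card ≤ Δ - 1 := by
    have h1 := hdeg x
    unfold deg at h1
    rw [Set.ncard_eq_toFinset_card'] at h1
    rw [hN, Finset.card_erase_of_mem (by simpa using hxz)]
    omega
  have hcov := labelSum_cover ℓ C₁ x N (fun y => reachSet (T.deleteEdges {s(x, y)}) y) (by
    intro v hv
    by_cases hvx : v = x
    · exact Or.inl hvx
    · obtain ⟨y, h1, h2, h3⟩ := reach_first T x z v hv hvx
      exact Or.inr ⟨y, by simp [hN, h1, h2], h3⟩)
  have hbx := hb x
  have hL : ∀ d, (∀ y ∈ N, labelSum ℓ (reachSet (T.deleteEdges {s(x, y)}) y) ≤ d) →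
      labelSum ℓ C₁ ≤ Δ * d := by
    intro d hd
    apply arith1 b Δ _ d hΔ _ hbig
    have h1 := Finset.sum_le_card_nsmul N _ d hd
    rw [smul_eq_mul] at h1
    have h2 := Nat.mul_le_mul_right d hcard
    omega
  refine ⟨?_, ?_⟩
  · rcases N.eq_empty_or_nonempty with h0 | ⟨y, hy⟩
    · have := hL 0 (by simp [h0])
      omega
    · exact ⟨y, hNC y hy⟩
  · intro y _ _ hmax
    apply arith2 Δ _ _ _ _ hΔ (hL _ fun y' hy' => hmax y' (hNC y' hy').1 (hNC y' hy').2) hratio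
    rw [labelSum_compl_add]
    exact total_le ℓ _ _ fun v => reach_split T x z v (hT.connected x v)
end

section
/- For all natural numbers b, Δ ≥ 2 and t there exists N such that: for every finite tree T with maximum degree at most Δ and every vertex labelling ℓ : V(T) → ℕ with ℓ(v) ≤ b for all v and total label sum L ≥ N, the vertex set of T can be partitioned into 2^t nonempty parts, each inducing a connected subgraph of T, such that every part has label sum at least L / (Δ + 1)^t. -/
namespace TreePart

/-- Vertices reachable from `w` by a walk inside `X`. -/
def comp {V : Type*} (G : SimpleGraph V) (X : Set V) (w : V) : Set V :=
  {x | ∃ p : G.Walk w x, ∀ y ∈ p.support, y ∈ X}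

lemma comp_subset {V : Type*} (G : SimpleGraph V) (X : Set V) (w : V) : comp G X w ⊆ X := by
  rintro x ⟨p, hp⟩
  exact hp x p.end_mem_support

lemma mem_comp_self {V : Type*} (G : SimpleGraph V) (X : Set V) (w : V) (h : w ∈ X) :
    w ∈ comp G X w := by
  refine ⟨SimpleGraph.Walk.nil, ?_⟩
  intro y hy
  simp at hy
  exact hy ▸ h

lemma conn_patches {V : Type*} (G : SimpleGraph V) (s : Set V) (u : V) (hu : u ∈ s)
    (h : ∀ v ∈ s, ∃ s' ⊆ s, u ∈ s' ∧ v ∈ s' ∧ (G.induce s').Connected) :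
    (G.induce s).Connected := by
  apply G.induce_connected_of_patches u hu
  intro v hv
  obtain ⟨s', h1, h2, h3, h4⟩ := h v hv
  exact ⟨s', h1, h2, h3, h4.preconnected _ _⟩

lemma comp_connected {V : Type*} (G : SimpleGraph V) (X : Set V) (w : V) (h : w ∈ X) :
    (G.induce (comp G X w)).Connected := by
  classical
  apply conn_patches G _ w (mem_comp_self G X w h)
  rintro x ⟨p, hp⟩
  refine ⟨{y | y ∈ p.support}, ?_, p.start_mem_support, p.end_mem_support,
    p.connected_induce_support⟩
  intro y hy
  exact ⟨p.takeUntil y hy, fun z hz => hp z (p.support_takeUntil_subset_support hy hz)⟩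

lemma comp_eq {V : Type*} (G : SimpleGraph V) (X : Set V) (w w' x y : V)
    (h1 : x ∈ comp G X w) (h2 : x ∈ comp G X w') (h3 : y ∈ comp G X w') : y ∈ comp G X w := by
  obtain ⟨p, hp⟩ := h1
  obtain ⟨q, hq⟩ := h2
  obtain ⟨r, hr⟩ := h3
  refine ⟨(p.append q.reverse).append r, ?_⟩
  intro z hz
  simp only [SimpleGraph.Walk.mem_support_append_iff, SimpleGraph.Walk.support_reverse,
    List.mem_reverse] at hz
  rcases hz with (hz | hz) | hz
  · exact hp z hz
  · exact hq z hz
  · exact hr z hz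

lemma exists_comp {V : Type*} (G : SimpleGraph V) (A : Set V) (hA : (G.induce A).Connected)
    (v x : V) (hv : v ∈ A) (hx : x ∈ A) (hne : x ≠ v) :
    ∃ w ∈ A, G.Adj v w ∧ w ∈ A \ {v} ∧ x ∈ comp G (A \ {v}) w := by
  classical
  obtain ⟨p0⟩ := hA.preconnected ⟨v, hv⟩ ⟨x, hx⟩
  have key : ∃ p : G.Walk v x, p.IsPath ∧ ∀ y ∈ p.support, y ∈ A := by
    refine ⟨(p0.map (SimpleGraph.Embedding.induce A).toHom).bypass,
      SimpleGraph.Walk.bypass_isPath _, ?_⟩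
    intro y hy
    have h1 := SimpleGraph.Walk.support_bypass_subset_support _ hy
    have h2 := SimpleGraph.Walk.support_map (SimpleGraph.Embedding.induce (G := G) A).toHom p0
    have h3 : y ∈ p0.support.map (SimpleGraph.Embedding.induce (G := G) A).toHom := h2 ▸ h1
    obtain ⟨z, _, rfl⟩ := List.mem_map.1 h3
    exact z.2
  obtain ⟨p, hp, hpA⟩ := key
  cases p with
  | nil => exact absurd rfl hne
  | cons h q =>
    rename_i w
    rw [SimpleGraph.Walk.cons_isPath_iff] at hp
    have hq : ∀ y ∈ q.support, y ∈ A \ {v} := by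
      intro y hy
      refine ⟨hpA y (by simp [hy]), ?_⟩
      rintro rfl
      exact hp.2 hy
    have hw := hq w q.start_mem_support
    exact ⟨w, hw.1, h, hw, q, hq⟩

lemma conn_insert {V : Type*} (G : SimpleGraph V) (B : Set V) (hB : (G.induce B).Connected)
    (v u : V) (hu : u ∈ B) (h : G.Adj u v) : (G.induce (B ∪ {v})).Connected := by
  have : (G.induce ({v} : Set V)).Connected := by
    apply conn_patches G _ v (Set.mem_singleton v)
    rintro x rfl
    exact ⟨{y | y ∈ (SimpleGraph.Walk.nil : G.Walk x x).support}, by simp, by simp, by simp,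
      SimpleGraph.Walk.connected_induce_support _⟩
  exact G.connected_induce_union hB.preconnected this.preconnected hu (Set.mem_singleton v) h

lemma labelSum_compl {V : Type*} [Fintype V] (ℓ : V → ℕ) (A S : Set V) (h : A ⊆ S) :
    labelSum ℓ S = labelSum ℓ A + labelSum ℓ (S \ A) := by
  classical
  unfold labelSum
  rw [← Finset.sum_add_distrib]
  apply Finset.sum_congr rfl
  intro x _
  by_cases h1 : x ∈ A
  · simp [h1, h h1]
  · by_cases h2 : x ∈ S <;> simp [h1, h2]

lemma labelSum_cover {V : Type*} [Fintype V] (ℓ : V → ℕ) (b : ℕ) (hb : ∀ v, ℓ v ≤ b)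
    (A : Set V) (v : V) (F : Finset V) (C : V → Set V)
    (h : ∀ x ∈ A, x ≠ v → ∃ w ∈ F, x ∈ C w) :
    labelSum ℓ A ≤ b + ∑ w ∈ F, labelSum ℓ (C w) := by
  classical
  have h0 : b = ∑ x : V, if x = v then b else 0 := by simp
  unfold labelSum
  rw [h0, Finset.sum_comm, ← Finset.sum_add_distrib]
  apply Finset.sum_le_sum
  intro x _
  by_cases h1 : x ∈ A
  · by_cases h2 : x = v
    · have := hb x
      subst h2
      rw [if_pos h1, if_pos rfl]
      omega
    · obtain ⟨w, hw, hx⟩ := h x h1 h2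
      have := Finset.single_le_sum (f := fun w => if x ∈ C w then ℓ x else 0)
        (fun _ _ => Nat.zero_le _) hw
      simp only [hx, if_true] at this
      simp only [h1, if_true]
      omega
  · simp [h1]

lemma split {V : Type*} [Fintype V] (G : SimpleGraph V) (b Δ : ℕ) (hΔ : 2 ≤ Δ)
    (hdeg : ∀ v, deg G v ≤ Δ) (ℓ : V → ℕ) (hb : ∀ v, ℓ v ≤ b) (S : Set V)
    (hS : (G.induce S).Connected) (hL : (Δ + 1) * (b + 1) ≤ labelSum ℓ S) :
    ∃ A ⊆ S, (G.induce A).Connected ∧ (G.induce (S \ A)).Connected ∧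
      labelSum ℓ S ≤ (Δ + 1) * labelSum ℓ A ∧ labelSum ℓ S ≤ (Δ + 1) * labelSum ℓ (S \ A) := by
  classical
  suffices H : ∀ n : ℕ, ∀ (A : Set V) (v : V), A.ncard = n → A ⊆ S → v ∈ A →
      (G.induce A).Connected → labelSum ℓ S ≤ (Δ + 1) * labelSum ℓ A →
      (A = S ∨ ((G.induce (S \ A)).Connected ∧ ∃ u ∈ S \ A, G.Adj u v)) →
      ∃ A ⊆ S, (G.induce A).Connected ∧ (G.induce (S \ A)).Connected ∧
      labelSum ℓ S ≤ (Δ + 1) * labelSum ℓ A ∧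
      labelSum ℓ S ≤ (Δ + 1) * labelSum ℓ (S \ A) by
    obtain ⟨v, hv⟩ := hS.nonempty
    exact H _ S v rfl le_rfl hv hS (by nlinarith) (Or.inl rfl)
  intro n
  induction n using Nat.strong_induction_on with
  | _ n ih =>
  intro A v hn hAS hv hA hheavy hB
  set F : Finset V := Finset.univ.filter (fun w => G.Adj v w ∧ w ∈ A) with hF
  set C : V → Set V := fun w => comp G (A \ {v}) w with hC
  have hcov : ∀ x ∈ A, x ≠ v → ∃ w ∈ F, x ∈ C w := by
    intro x hx hne
    obtain ⟨w, hwA, hadj, _, hxw⟩ := exists_comp G A hA v x hv hx hne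
    exact ⟨w, by simp [hF, hadj, hwA], hxw⟩
  by_cases hex : ∃ w ∈ F, labelSum ℓ S ≤ (Δ + 1) * labelSum ℓ (C w)
  · obtain ⟨w, hwF, hw⟩ := hex
    obtain ⟨hadj, hwA⟩ : G.Adj v w ∧ w ∈ A := by simpa [hF] using hwF
    have hwX : w ∈ A \ {v} := ⟨hwA, hadj.ne'⟩
    have hsub : C w ⊆ A \ {v} := comp_subset G _ w
    have hvC : v ∉ C w := fun h => (hsub h).2 rfl
    refine ih (C w).ncard ?_ (C w) w rfl (fun x hx => hAS (hsub hx).1)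
      (mem_comp_self G _ w hwX) (comp_connected G _ w hwX) hw (Or.inr ⟨?_, v, ⟨hAS hv, hvC⟩, hadj⟩)
    · rw [← hn]
      apply Set.ncard_lt_ncard _ (Set.toFinite _)
      exact ⟨fun x hx => (hsub hx).1, fun h => hvC (h hv)⟩
    · have hvS : v ∈ S \ C w := ⟨hAS hv, hvC⟩
      apply conn_patches G (S \ C w) v hvS
      intro x hx
      by_cases hxv : x = v
      · subst hxv
        refine ⟨{y | y ∈ (SimpleGraph.Walk.nil : G.Walk x x).support}, ?_, by simp, by simp,
          SimpleGraph.Walk.connected_induce_support _⟩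
        intro y hy
        simp at hy
        exact hy ▸ hx
      by_cases hxA : x ∈ A
      · obtain ⟨w', hw'A, hadj', hw'X, hxw'⟩ := exists_comp G A hA v x hv hxA hxv
        refine ⟨comp G (A \ {v}) w' ∪ {v}, ?_, Or.inr rfl, Or.inl hxw',
          conn_insert G _ (comp_connected G _ w' hw'X) v w' (mem_comp_self G _ w' hw'X) hadj'.symm⟩
        rintro y (hy | hy)
        · refine ⟨hAS (comp_subset G _ _ hy).1, fun hyC => hx.2 ?_⟩
          exact comp_eq G _ w w' y x hyC hy hxw'
        · rw [Set.mem_singleton_iff] at hy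
          exact hy ▸ ⟨hAS hv, hvC⟩
      · rcases hB with rfl | ⟨hB, u, hu, huv⟩
        · exact absurd hx.1 hxA
        · refine ⟨(S \ A) ∪ {v}, ?_, Or.inr rfl, Or.inl ⟨hx.1, hxA⟩, conn_insert G _ hB v u hu huv⟩
          rintro y (hy | hy)
          · exact ⟨hy.1, fun h => hy.2 (hsub h).1⟩
          · rw [Set.mem_singleton_iff] at hy
            exact hy ▸ ⟨hAS hv, hvC⟩
  · push Not at hex
    have h1 := labelSum_cover ℓ b hb A v F C hcov
    have h2 : (Δ + 1) * ∑ w ∈ F, labelSum ℓ (C w) ≤ F.card * labelSum ℓ S := by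
      rw [Finset.mul_sum, ← smul_eq_mul (a := F.card)]
      exact Finset.sum_le_card_nsmul _ _ _ (fun w hw => (hex w hw).le)
    have hd : deg G v = (Finset.univ.filter (fun w => G.Adj v w)).card := by
      unfold deg
      rw [← Set.ncard_coe_finset]
      congr 1
      ext w
      simp
    have hdv := hdeg v
    have hadd := labelSum_compl ℓ A S hAS
    rcases hB with rfl | ⟨hB, u, hu, huv⟩
    · exfalso
      have hc : F.card ≤ Δ := by
        refine le_trans (Finset.card_le_card ?_) (hd ▸ hdv)
        intro w hw
        simp [hF] at hw ⊢
        exact hw.1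
      have := Nat.mul_le_mul_right (labelSum ℓ A) hc
      nlinarith
    · have hc : F.card + 1 ≤ Δ := by
        have hu' : u ∉ F := by
          simp only [hF, Finset.mem_filter, not_and]
          exact fun _ _ => hu.2
        rw [← Finset.card_insert_of_notMem hu']
        refine le_trans (Finset.card_le_card ?_) (hd ▸ hdv)
        intro w hw
        simp [hF] at hw ⊢
        rcases hw with rfl | hw
        · exact huv.symm
        · exact hw.1
      refine ⟨A, hAS, hA, hB, hheavy, ?_⟩
      have := Nat.mul_le_mul_right (labelSum ℓ S) hc
      nlinarith

lemma main {V : Type*} [Fintype V] (G : SimpleGraph V) (b Δ : ℕ) (hΔ : 2 ≤ Δ)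
    (hdeg : ∀ v, deg G v ≤ Δ) (ℓ : V → ℕ) (hb : ∀ v, ℓ v ≤ b) (t : ℕ) : ∀ (S : Set V),
    (G.induce S).Connected → (Δ + 1) ^ t * (b + 1) ≤ labelSum ℓ S →
    ∃ P : Fin (2 ^ t) → Set V,
        (∀ i, (G.induce (P i)).Connected) ∧
        (∀ i j, i ≠ j → Disjoint (P i) (P j)) ∧
        (⋃ i, P i) = S ∧
        (∀ i, labelSum ℓ S ≤ (Δ + 1) ^ t * labelSum ℓ (P i)) := by
  induction t with
  | zero =>
    intro S hS _
    refine ⟨fun _ => S, fun _ => hS, ?_, ?_, by simp⟩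
    · intro i j hij
      exact absurd (Subsingleton.elim (α := Fin 1) i j) hij
    · have : Nonempty (Fin (2 ^ 0)) := ⟨⟨0, by simp⟩⟩
      exact Set.iUnion_const S
  | succ t ih =>
    intro S hS hL
    have hpow : 1 ≤ (Δ + 1) ^ t := Nat.one_le_pow _ _ (by omega)
    have e1 : (Δ + 1) ^ (t + 1) * (b + 1) = (Δ + 1) * ((Δ + 1) ^ t * (b + 1)) := by ring
    obtain ⟨A, hAS, hA, hB, h1, h2⟩ := split G b Δ hΔ hdeg ℓ hb S hS (by
      refine le_trans ?_ hL
      rw [e1]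
      exact Nat.mul_le_mul_left _ (Nat.le_mul_of_pos_left _ hpow))
    obtain ⟨P, p1, p2, p3, p4⟩ := ih A hA
      (Nat.le_of_mul_le_mul_left ((e1 ▸ hL).trans h1) (by omega))
    obtain ⟨Q, q1, q2, q3, q4⟩ := ih (S \ A) hB
      (Nat.le_of_mul_le_mul_left ((e1 ▸ hL).trans h2) (by omega))
    let e : Fin (2 ^ (t + 1)) ≃ Fin (2 ^ t) ⊕ Fin (2 ^ t) :=
      (finCongr (by ring)).trans finSumFinEquiv.symm
    have hPQ : ∀ i j, Disjoint (P i) (Q j) := by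
      intro i j
      refine Set.disjoint_left.2 fun x hx hx' => ?_
      have a1 : x ∈ A := p3 ▸ Set.mem_iUnion_of_mem i hx
      have a2 : x ∈ S \ A := q3 ▸ Set.mem_iUnion_of_mem j hx'
      exact a2.2 a1
    have hall : ∀ s : Fin (2 ^ t) ⊕ Fin (2 ^ t), (G.induce (Sum.elim P Q s)).Connected ∧
        labelSum ℓ S ≤ (Δ + 1) ^ (t + 1) * labelSum ℓ (Sum.elim P Q s) := by
      rintro (i | i)
      · refine ⟨p1 i, h1.trans ?_⟩
        rw [pow_succ', mul_assoc]
        exact Nat.mul_le_mul_left _ (p4 i)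
      · refine ⟨q1 i, h2.trans ?_⟩
        rw [pow_succ', mul_assoc]
        exact Nat.mul_le_mul_left _ (q4 i)
    have hdis : ∀ s s' : Fin (2 ^ t) ⊕ Fin (2 ^ t), s ≠ s' →
        Disjoint (Sum.elim P Q s) (Sum.elim P Q s') := by
      rintro (i | i) (j | j) hij
      · exact p2 i j (fun h => hij (h ▸ rfl))
      · exact hPQ i j
      · exact (hPQ j i).symm
      · exact q2 i j (fun h => hij (h ▸ rfl))
    refine ⟨fun i => Sum.elim P Q (e i), fun i => (hall _).1,
      fun i j hij => hdis _ _ (fun h => hij (e.injective h)), ?_, fun i => (hall _).2⟩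
    rw [e.surjective.iUnion_comp (fun s => Sum.elim P Q s), Set.iUnion_sum]
    simp only [Sum.elim_inl, Sum.elim_inr]
    rw [p3, q3, Set.union_sdiff_cancel hAS]

end TreePart

/-- For all `b`, `Δ ≥ 2` and `t` there is `N` such that for every finite tree `T` of
maximum degree at most `Δ`, with vertex labels bounded by `b` and of total sum
`L ≥ N`, the vertex set of `T` can be partitioned into `2^t` nonempty connected
parts each of label sum at least `L / (Δ+1)^t`
(stated multiplicatively: `L ≤ (Δ+1)^t · ℓ(part)`). -/
theorem tree_partition_into_heavy_connected_parts (b Δ t : ℕ) (hΔ : 2 ≤ Δ) :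
    ∃ N : ℕ, ∀ (V : Type) [Fintype V] (T : SimpleGraph V), T.IsTree →
      (∀ v, deg T v ≤ Δ) → ∀ ℓ : V → ℕ, (∀ v, ℓ v ≤ b) → N ≤ ∑ v, ℓ v →
      ∃ P : Fin (2 ^ t) → Set V,
        (∀ i, (P i).Nonempty) ∧
        (∀ i, (T.induce (P i)).Connected) ∧
        (∀ i j, i ≠ j → Disjoint (P i) (P j)) ∧
        (⋃ i, P i) = Set.univ ∧
        (∀ i, (∑ v, ℓ v) ≤ (Δ + 1) ^ t * labelSum ℓ (P i)) := by
  refine ⟨(Δ + 1) ^ t * (b + 1), ?_⟩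
  intro V _ T hT hdeg ℓ hb hL
  have hu : labelSum ℓ Set.univ = ∑ v, ℓ v := by simp [labelSum]
  have hconn : (T.induce Set.univ).Connected :=
    (SimpleGraph.induceUnivIso T).connected_iff.2 hT.connected
  obtain ⟨P, h1, h2, h3, h4⟩ := TreePart.main T b Δ hΔ hdeg ℓ hb t Set.univ hconn (hu ▸ hL)
  rw [hu] at h4
  exact ⟨P, fun i => Set.nonempty_coe_sort.1 (h1 i).nonempty, h1, h2, h3, h4⟩
end

section
/- Let G be a finite connected simple graph in which every vertex has degree at most 4 and whose deficit satisfies Σ_{v ∈ V(G)} (4 − deg(v)) ≤ 4. If M is a matching in G with m ≥ 1 edges, then the number of edges of G not belonging to M is at least 3m − 2. -/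
/-- `M` is a matching in `G`: a set of edges of `G`, no two of which share an endpoint. -/
def IsMatchingIn {V : Type*} (M : Set (Sym2 V)) (G : SimpleGraph V) : Prop :=
  M ⊆ G.edgeSet ∧ ∀ e ∈ M, ∀ f ∈ M, e ≠ f → ∀ v : V, v ∈ e → v ∉ f

/-- Let `G` be a finite connected simple graph of maximum degree at most 4 whose
total deficit `∑ (4 - deg v)` is at most 4.  If `M` is a matching in `G` with
`m ≥ 1` edges, then `G` has at least `3m - 2` edges not in `M`. -/
theorem low_deficit_component_many_nonmatching_edges (V : Type) [Fintype V]
    (G : SimpleGraph V) (hconn : G.Connected)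
    (hdeg : ∀ v, deg G v ≤ 4)
    (hdef : ∑ v : V, (4 - deg G v) ≤ 4)
    (M : Set (Sym2 V)) (hM : IsMatchingIn M G)
    (m : ℕ) (hm : M.ncard = m) (hm1 : 1 ≤ m) :
    3 * m - 2 ≤ (G.edgeSet \ M).ncard := by
  classical
  have hd : ∀ v, deg G v = G.degree v := by
    intro v
    unfold deg
    rw [Set.ncard_eq_toFinset_card', ← SimpleGraph.card_neighborFinset_eq_degree]
    rfl
  have hs := G.sum_degrees_eq_twice_card_edges
  have h1 : ∑ v : V, (4 - deg G v) + ∑ v : V, G.degree v = Fintype.card V * 4 := by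
    rw [← Finset.sum_add_distrib, Finset.sum_congr rfl (g := fun _ => 4)]
    · simp
    · intro v _
      have := hdeg v
      have := hd v
      omega
  have h2 : (M.toFinset.biUnion fun e => e.toFinset).card = M.toFinset.card * 2 := by
    rw [Finset.card_biUnion, Finset.sum_congr rfl (g := fun _ => 2)]
    · simp
    · intro e he
      exact Sym2.card_toFinset_of_not_isDiag e
        (G.not_isDiag_of_mem_edgeSet (hM.1 (Set.mem_toFinset.1 he)))
    · intro e he f hf hne
      refine Finset.disjoint_left.2 ?_
      intro v hv hv'
      exact hM.2 e (Set.mem_toFinset.1 (Finset.mem_coe.1 he)) f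
        (Set.mem_toFinset.1 (Finset.mem_coe.1 hf)) hne v
        (Sym2.mem_toFinset.1 hv) (Sym2.mem_toFinset.1 hv')
  have h3 := Finset.card_le_univ (M.toFinset.biUnion fun e => e.toFinset)
  have h4 : M.toFinset.card = m := by rw [← hm, Set.ncard_eq_toFinset_card']
  have h5 : G.edgeSet.ncard = G.edgeFinset.card := by
    rw [Set.ncard_eq_toFinset_card']
    rfl
  rw [Set.ncard_sdiff hM.1 (Set.toFinite M), h5, hm]
  omega
end
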